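/- arXiv:1802.06976 — 3 statements merged into one kernel-verified Lean document; each statement's English description precedes it below -/
import Mathlib

section
/- For every integer n ≥ 2: (i) the set of real numbers α such that ψ_α[A+B] − ψ_α[A] − ψ_α[B] is positive semidefinite for all n×n real symmetric positive semidefinite matrices A, B equals {odd positive integers} ∪ [n, ∞); and (ii) the set of real numbers α such that φ_α[A+B] − φ_α[A] − φ_α[B] is positive semidefinite for all n×n real symmetric positive semidefinite matrices A, B equals {even positive integers} ∪ [n, ∞). -/
open Matrix

/-- Entrywise power with the convention `0 ^ α := 0` for all `α`. -/
noncomputable def powF (α x : ℝ) : ℝ := if x = 0 then 0 else x ^ α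

/-- `ψ_α(x) := sgn(x) * |x| ^ α`, with `ψ_α(0) := 0`. -/
noncomputable def psiF (α x : ℝ) : ℝ := if x = 0 then 0 else Real.sign x * |x| ^ α

/-- `φ_α(x) := |x| ^ α`, with `φ_α(0) := 0`. -/
noncomputable def phiF (α x : ℝ) : ℝ := if x = 0 then 0 else |x| ^ α

/-- Both families at once: `true` is `ψ`, `false` is `φ`. -/
noncomputable def bothF (b : Bool) (α x : ℝ) : ℝ := if b then psiF α x else phiF α x

/-- The sign of `bothF b α (-1)`. -/
noncomputable def sgB (b : Bool) : ℝ := if b then -1 else 1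

lemma bothF_zero (b : Bool) (α : ℝ) : bothF b α 0 = 0 := by
  cases b <;> simp [bothF, psiF, phiF]

lemma bothF_pos (b : Bool) (α : ℝ) {x : ℝ} (hx : 0 < x) : bothF b α x = x ^ α := by
  cases b <;> simp [bothF, psiF, phiF, hx.ne', abs_of_pos hx, Real.sign_of_pos hx]

lemma bothF_neg (b : Bool) (α : ℝ) {x : ℝ} (hx : x < 0) :
    bothF b α x = sgB b * (-x) ^ α := by
  cases b <;> simp [bothF, sgB, psiF, phiF, hx.ne, abs_of_neg hx, Real.sign_of_neg hx]

lemma sgB_mul (b : Bool) : sgB b * sgB b = 1 := by cases b <;> simp [sgB]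

lemma bothF_mul (b : Bool) (α x y : ℝ) : bothF b α (x * y) = bothF b α x * bothF b α y := by
  rcases lt_trichotomy x 0 with hx | rfl | hx
  · rcases lt_trichotomy y 0 with hy | rfl | hy
    · rw [bothF_pos b α (mul_pos_of_neg_of_neg hx hy), bothF_neg b α hx, bothF_neg b α hy,
        ← neg_mul_neg, Real.mul_rpow (by linarith) (by linarith)]
      linear_combination (-(-x) ^ α * (-y) ^ α) * sgB_mul b
    · simp [bothF_zero]
    · rw [bothF_neg b α (mul_neg_of_neg_of_pos hx hy), bothF_neg b α hx, bothF_pos b α hy,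
        ← neg_mul, Real.mul_rpow (by linarith) (by linarith)]
      ring
  · simp [bothF_zero]
  · rcases lt_trichotomy y 0 with hy | rfl | hy
    · rw [bothF_neg b α (mul_neg_of_pos_of_neg hx hy), bothF_pos b α hx, bothF_neg b α hy,
        ← mul_neg, Real.mul_rpow (by linarith) (by linarith)]
      ring
    · simp [bothF_zero]
    · rw [bothF_pos b α (mul_pos hx hy), bothF_pos b α hx, bothF_pos b α hy,
        Real.mul_rpow (by linarith) (by linarith)]

lemma bothF_nonneg (b : Bool) (α : ℝ) {x : ℝ} (hx : 0 ≤ x) : 0 ≤ bothF b α x := by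
  rcases hx.eq_or_lt with rfl | hx
  · rw [bothF_zero]
  · rw [bothF_pos b α hx]; positivity

lemma bothF_mono (b : Bool) {α : ℝ} (hα : 0 < α) {x y : ℝ} (hx : 0 ≤ x) (hxy : x ≤ y) :
    bothF b α x ≤ bothF b α y := by
  rcases hx.eq_or_lt with rfl | hx
  · rw [bothF_zero]; exact bothF_nonneg b α hxy
  · rw [bothF_pos b α hx, bothF_pos b α (hx.trans_le hxy)]
    exact Real.rpow_le_rpow hx.le hxy hα.le

lemma bothF_norm (b : Bool) {α : ℝ} (hα : 0 < α) (x : ℝ) : ‖bothF b α x‖ = |x| ^ α := by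
  rcases lt_trichotomy x 0 with hx | rfl | hx
  · rw [bothF_neg b α hx, abs_of_neg hx]
    have : 0 ≤ (-x) ^ α := Real.rpow_nonneg (by linarith) _
    cases b <;> simp [sgB, abs_of_nonneg this]
  · simp [bothF_zero, Real.zero_rpow hα.ne']
  · rw [bothF_pos b α hx, abs_of_pos hx, Real.norm_of_nonneg (by positivity)]

lemma sgB_not (b : Bool) : sgB (!b) = - sgB b := by cases b <;> simp [sgB]

lemma bothF_deriv (b : Bool) {α : ℝ} (hα : 1 < α) (x : ℝ) :
    HasDerivAt (bothF b α) (α * bothF (!b) (α - 1) x) x := by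
  rcases lt_trichotomy x 0 with hx | rfl | hx
  · have h1 : HasDerivAt (fun y : ℝ => sgB b * (-y) ^ α)
        (sgB b * ((-1) * α * (-x) ^ (α - 1))) x := by
      apply HasDerivAt.const_mul
      exact (hasDerivAt_neg x).rpow_const (Or.inr hα.le)
    have h2 : bothF b α =ᶠ[nhds x] fun y : ℝ => sgB b * (-y) ^ α := by
      filter_upwards [Iio_mem_nhds hx] with y hy
      exact bothF_neg b α hy
    rw [bothF_neg _ _ hx, sgB_not]
    have e : α * (-sgB b * (-x) ^ (α - 1)) = sgB b * ((-1) * α * (-x) ^ (α - 1)) := by ring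
    rw [e]
    exact h1.congr_of_eventuallyEq h2
  · rw [bothF_zero, mul_zero]
    have h0 := hasDerivAt_abs_rpow 0 hα
    rw [hasDerivAt_iff_isLittleO] at h0 ⊢
    simp only [abs_zero, Real.zero_rpow (by linarith : α ≠ 0), mul_zero, sub_zero, smul_zero,
      bothF_zero] at h0 ⊢
    refine Asymptotics.IsBigO.trans_isLittleO ?_ h0
    apply Asymptotics.IsBigO.of_norm_le
    intro y
    rw [bothF_norm b (by linarith)]
  · have h1 : HasDerivAt (fun y : ℝ => y ^ α) (α * x ^ (α - 1)) x :=
      Real.hasDerivAt_rpow_const (Or.inr hα.le)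
    have h2 : bothF b α =ᶠ[nhds x] fun y : ℝ => y ^ α := by
      filter_upwards [Ioi_mem_nhds hx] with y hy
      exact bothF_pos b α hy
    rw [bothF_pos _ _ hx]
    exact h1.congr_of_eventuallyEq h2

lemma psd_iff {n : ℕ} (M : Matrix (Fin n) (Fin n) ℝ) :
    M.PosSemidef ↔ (∀ i j, M i j = M j i) ∧ ∀ v : Fin n → ℝ,
      0 ≤ ∑ i, ∑ j, v i * v j * M i j := by
  rw [posSemidef_iff_dotProduct_mulVec]
  have key : ∀ v : Fin n → ℝ, star v ⬝ᵥ (M *ᵥ v) = ∑ i, ∑ j, v i * v j * M i j := by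
    intro v
    simp only [dotProduct, mulVec, Finset.mul_sum, Pi.star_apply, star_trivial]
    exact Finset.sum_congr rfl fun i _ => Finset.sum_congr rfl fun j _ => by ring
  simp only [key]
  refine and_congr ⟨fun h i j => ?_, fun h => ?_⟩ Iff.rfl
  · simpa using h.apply j i
  · ext i j
    simpa using h j i

lemma quad_mono {n : ℕ} (v : Fin n → ℝ) (g g' : Fin n → Fin n → ℝ → ℝ)
    (hg : ∀ i j t, HasDerivAt (g i j) (g' i j t) t)
    (h : ∀ t, 0 < t → t < 1 → 0 ≤ ∑ i, ∑ j, v i * v j * g' i j t) :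
    ∑ i, ∑ j, v i * v j * g i j 0 ≤ ∑ i, ∑ j, v i * v j * g i j 1 := by
  have hd : ∀ t, HasDerivAt (fun t => ∑ i, ∑ j, v i * v j * g i j t)
      (∑ i, ∑ j, v i * v j * g' i j t) t := by
    intro t
    refine HasDerivAt.fun_sum fun i _ => HasDerivAt.fun_sum fun j _ => ?_
    exact (hg i j t).const_mul _
  have hm : MonotoneOn (fun t => ∑ i, ∑ j, v i * v j * g i j t) (Set.Icc 0 1) := by
    refine monotoneOn_of_deriv_nonneg (convex_Icc 0 1)
      (fun t _ => (hd t).continuousAt.continuousWithinAt)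
      (fun t _ => (hd t).differentiableAt.differentiableWithinAt) ?_
    intro t ht
    rw [interior_Icc] at ht
    rw [(hd t).deriv]
    exact h t ht.1 ht.2
  exact hm (by simp) (by simp) zero_le_one

lemma line_deriv (b : Bool) {α : ℝ} (hα : 1 < α) (a c t : ℝ) :
    HasDerivAt (fun t => bothF b α (a + t * c))
      (α * (c * bothF (!b) (α - 1) (a + t * c))) t := by
  have h1 : HasDerivAt (fun t : ℝ => a + t * c) c t := by
    simpa using ((hasDerivAt_id t).mul_const c).const_add a
  have := (bothF_deriv b hα (a + t * c)).comp t h1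
  have e : α * (c * bothF (!b) (α - 1) (a + t * c)) =
      α * bothF (!b) (α - 1) (a + t * c) * c := by ring
  rw [e]
  exact this

lemma base_two (b : Bool) {α : ℝ} (hα : 0 < α) (A : Matrix (Fin 2) (Fin 2) ℝ)
    (hA : A.PosSemidef) : (A.map (bothF b α)).PosSemidef := by
  have hs := ((psd_iff A).1 hA).1
  rw [psd_iff]
  refine ⟨fun i j => by simp [hs i j], fun v => ?_⟩
  have h0 := hA.diag_nonneg (i := 0)
  have h1 := hA.diag_nonneg (i := 1)
  have hd := hA.det_nonneg
  rw [det_fin_two, hs 1 0] at hd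
  simp only [Fin.sum_univ_two, map_apply, hs 1 0]
  have hp := bothF_nonneg b α h0
  have hr := bothF_nonneg b α h1
  have hq := bothF_mono b hα (mul_self_nonneg (A 0 1)) (by linarith : A 0 1 * A 0 1 ≤ A 0 0 * A 1 1)
  rw [bothF_mul, bothF_mul] at hq
  generalize bothF b α (A 0 0) = p at *
  generalize bothF b α (A 1 1) = r at *
  generalize bothF b α (A 0 1) = q at *
  rcases hp.eq_or_lt with rfl | hp
  · have : q = 0 := by nlinarith
    subst this
    nlinarith [mul_nonneg hr (mul_self_nonneg (v 1))]
  · have : 0 ≤ p * (v 0 * v 0 * p + v 0 * v 1 * q + (v 1 * v 0 * q + v 1 * v 1 * r)) := by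
      nlinarith [sq_nonneg (p * v 0 + q * v 1), mul_nonneg (sub_nonneg.2 hq) (mul_self_nonneg (v 1))]
    have := nonneg_of_mul_nonneg_right this hp
    linarith

lemma had_psd {n : ℕ} {A B : Matrix (Fin n) (Fin n) ℝ} (hA : A.PosSemidef) (hB : B.PosSemidef)
    (v : Fin n → ℝ) : 0 ≤ ∑ i, ∑ j, v i * v j * (A i j * B i j) := by
  have := ((psd_iff _).1 (hA.hadamard hB)).2 v
  simpa using this

lemma smul_nonneg_sum {n : ℕ} (v : Fin n → ℝ) {α : ℝ} (hα : 0 ≤ α) (M : Fin n → Fin n → ℝ)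
    (h : 0 ≤ ∑ i, ∑ j, v i * v j * M i j) : 0 ≤ ∑ i, ∑ j, v i * v j * (α * M i j) := by
  have : ∑ i, ∑ j, v i * v j * (α * M i j) = α * ∑ i, ∑ j, v i * v j * M i j := by
    simp only [Finset.mul_sum]
    exact Finset.sum_congr rfl fun i _ => Finset.sum_congr rfl fun j _ => by ring
  rw [this]
  positivity

lemma psd_smul {n : ℕ} {A : Matrix (Fin n) (Fin n) ℝ} (hA : A.PosSemidef) {t : ℝ} (ht : 0 ≤ t) :
    (t • A).PosSemidef := by
  have h := (psd_iff _).1 hA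
  rw [psd_iff]
  refine ⟨fun i j => by simp [h.1 i j], fun v => ?_⟩
  simpa using smul_nonneg_sum v ht A (h.2 v)

/-- Rank one matrices -/
lemma rank_one_sum {n : ℕ} (v u w : Fin n → ℝ) :
    ∑ i, ∑ j, v i * v j * (u i * w j) = (∑ i, v i * u i) * (∑ i, v i * w i) := by
  rw [Finset.sum_mul_sum]
  exact Finset.sum_congr rfl fun i _ => Finset.sum_congr rfl fun j _ => by ring

lemma zero_row {n : ℕ} {A : Matrix (Fin n) (Fin n) ℝ} (hA : A.PosSemidef) (k : Fin n)
    (h : A k k = 0) (i : Fin n) : A i k = 0 := by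
  have hs := ((psd_iff A).1 hA).1
  by_cases hik : i = k
  · rw [hik, h]
  have hd := (hA.submatrix ![i, k]).det_nonneg
  rw [det_fin_two] at hd
  simp [h, hs k i] at hd
  nlinarith

/-- Schur complement. -/
lemma schur_psd {n : ℕ} {A : Matrix (Fin n) (Fin n) ℝ} (hA : A.PosSemidef) (k : Fin n) :
    (A - Matrix.of fun i j => A i k * A j k * (A k k)⁻¹).PosSemidef := by
  have h := (psd_iff _).1 hA
  rw [psd_iff]
  refine ⟨fun i j => by simp only [Matrix.sub_apply, of_apply, h.1 i j]; ring, fun v => ?_⟩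
  rcases eq_or_ne (A k k) 0 with h0 | h0
  · simpa [h0] using h.2 v
  set s := ∑ i, v i * A i k with hs
  have h2 := h.2 (fun i => v i - (s * (A k k)⁻¹) * (Pi.single k 1 : Fin n → ℝ) i)
  have e1 : ∑ i, ∑ j, v i * v j * (A - Matrix.of fun i j => A i k * A j k * (A k k)⁻¹) i j
      = (∑ i, ∑ j, v i * v j * A i j) - s * s * (A k k)⁻¹ := by
    rw [hs, ← rank_one_sum, Finset.sum_mul, ← Finset.sum_sub_distrib]
    refine Finset.sum_congr rfl fun i _ => ?_
    rw [Finset.sum_mul, ← Finset.sum_sub_distrib]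
    refine Finset.sum_congr rfl fun j _ => ?_
    simp; ring
  rw [e1]
  convert h2 using 1
  set c := s * (A k k)⁻¹ with hc
  have e2 : ∀ i j, (v i - c * (Pi.single k 1 : Fin n → ℝ) i) *
      (v j - c * (Pi.single k 1 : Fin n → ℝ) j) * A i j
      = v i * v j * A i j - c * ((Pi.single k 1 : Fin n → ℝ) i * (v j * A i j))
        - c * ((Pi.single k 1 : Fin n → ℝ) j * (v i * A i j))
        + c * c * ((Pi.single k 1 : Fin n → ℝ) i * ((Pi.single k 1 : Fin n → ℝ) j * A i j)) := by
    intro i j; ring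
  have e3 : ∑ j, v j * A k j = s := by
    rw [hs]; exact Finset.sum_congr rfl fun j _ => by rw [h.1 k j]
  simp only [e2, Finset.sum_add_distrib, Finset.sum_sub_distrib, ← Finset.mul_sum]
  simp [Pi.single_apply, e3, ← hs]
  rw [hc]; field_simp; ring

lemma pos_step (n : ℕ) (hn : 2 ≤ n)
    (ih : ∀ (b : Bool) (α : ℝ), (n : ℝ) - 2 < α → 0 < α → ∀ A : Matrix (Fin n) (Fin n) ℝ,
      A.PosSemidef → (A.map (bothF b α)).PosSemidef)
    (b : Bool) (α : ℝ) (hα : (n : ℝ) + 1 - 2 < α) (A : Matrix (Fin (n + 1)) (Fin (n + 1)) ℝ)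
    (hA : A.PosSemidef) : (A.map (bothF b α)).PosSemidef := by
  have hn' : (2 : ℝ) ≤ n := by exact_mod_cast hn
  have h1 : 1 < α := by linarith
  have hs := ((psd_iff A).1 hA).1
  set C : Matrix (Fin (n + 1)) (Fin (n + 1)) ℝ :=
    Matrix.of fun i j => A i 0 * A j 0 * (A 0 0)⁻¹ with hC
  have hD := schur_psd hA 0
  rw [← hC] at hD
  have h00 := hA.diag_nonneg (i := 0)
  have hCp : C.PosSemidef := by
    rw [psd_iff]
    refine ⟨fun i j => by simp only [hC, of_apply]; ring, fun v => ?_⟩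
    have : ∑ i, ∑ j, v i * v j * C i j
        = (∑ i, v i * A i 0) * (∑ i, v i * A i 0) * (A 0 0)⁻¹ := by
      rw [← rank_one_sum, Finset.sum_mul]
      refine Finset.sum_congr rfl fun i _ => ?_
      rw [Finset.sum_mul]
      refine Finset.sum_congr rfl fun j _ => ?_
      simp [hC]; ring
    rw [this]
    exact mul_nonneg (mul_self_nonneg _) (inv_nonneg.2 h00)
  have hD0 : ∀ i, (A - C) i 0 = 0 := by
    intro i
    rcases eq_or_ne (A 0 0) 0 with h0 | h0
    · simp [hC, zero_row hA 0 h0 i]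
    · simp [hC, mul_assoc, h0]
  have hDs := ((psd_iff _).1 hD).1
  rw [psd_iff]
  refine ⟨fun i j => by simp [hs i j], fun v => ?_⟩
  have hm := quad_mono v (fun i j t => bothF b α (C i j + t * (A - C) i j)) _
    (fun i j t => line_deriv b h1 _ _ t) ?_
  · have hz : 0 ≤ ∑ i, ∑ j, v i * v j * bothF b α (C i j) := by
      have : ∑ i, ∑ j, v i * v j * bothF b α (C i j)
          = (∑ i, v i * bothF b α (A i 0)) * (∑ i, v i * bothF b α (A i 0)) *
            bothF b α ((A 0 0)⁻¹) := by
        rw [← rank_one_sum, Finset.sum_mul]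
        refine Finset.sum_congr rfl fun i _ => ?_
        rw [Finset.sum_mul]
        refine Finset.sum_congr rfl fun j _ => ?_
        simp only [hC, of_apply, bothF_mul]; ring
      rw [this]
      exact mul_nonneg (mul_self_nonneg _) (bothF_nonneg b α (inv_nonneg.2 h00))
    simp at hm
    simp only [map_apply]
    linarith
  · intro t ht0 ht1
    apply smul_nonneg_sum v (by linarith)
    simp only [Fin.sum_univ_succ, hD0, hDs 0, mul_zero, zero_mul, zero_add, Finset.sum_const_zero]
    have hE := (hCp.add (psd_smul hD ht0.le)).submatrix Fin.succ
    have := had_psd (hD.submatrix Fin.succ) (ih (!b) (α - 1) (by linarith) (by linarith) _ hE)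
      (fun i => v i.succ)
    simpa using this

lemma pos_all (n : ℕ) (hn : 2 ≤ n) :
    ∀ (b : Bool) (α : ℝ), (n : ℝ) - 2 < α → 0 < α → ∀ A : Matrix (Fin n) (Fin n) ℝ,
      A.PosSemidef → (A.map (bothF b α)).PosSemidef := by
  induction n, hn using Nat.le_induction with
  | base => intro b α _ h0 A hA; exact base_two b h0 A hA
  | succ n hn ih =>
    intro b α h1 _ A hA
    push_cast at h1
    exact pos_step n hn ih b α h1 A hA

lemma mono_all (n : ℕ) (hn : 2 ≤ n) (b : Bool) (α : ℝ) (hα : (n : ℝ) - 1 < α) 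
    (A B : Matrix (Fin n) (Fin n) ℝ) (hA : A.PosSemidef) (hB : B.PosSemidef) :
    ((A + B).map (bothF b α) - A.map (bothF b α)).PosSemidef := by
  have hn' : (2 : ℝ) ≤ n := by exact_mod_cast hn
  have h1 : 1 < α := by linarith
  rw [psd_iff]
  have hsA := ((psd_iff A).1 hA).1
  have hsB := ((psd_iff B).1 hB).1
  refine ⟨fun i j => by simp [hsA i j, hsB i j], fun v => ?_⟩
  have hm := quad_mono v (fun i j t => bothF b α (A i j + t * B i j)) _
    (fun i j t => line_deriv b h1 _ _ t) ?_
  · simp at hm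
    simp only [Matrix.sub_apply, map_apply, Matrix.add_apply, mul_sub, Finset.sum_sub_distrib]
    linarith
  · intro t ht0 ht1
    apply smul_nonneg_sum v (by linarith)
    have := had_psd hB (pos_all n hn (!b) (α - 1) (by linarith) (by linarith) _
      (hA.add (psd_smul hB ht0.le))) v
    simpa using this

lemma super_lt (n : ℕ) (hn : 2 ≤ n) (b : Bool) (α : ℝ) (hα : (n : ℝ) < α) 
    (A B : Matrix (Fin n) (Fin n) ℝ) (hA : A.PosSemidef) (hB : B.PosSemidef) :
    ((A + B).map (bothF b α) - A.map (bothF b α) - B.map (bothF b α)).PosSemidef := by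
  have hn' : (2 : ℝ) ≤ n := by exact_mod_cast hn
  have h1 : 1 < α := by linarith
  rw [psd_iff]
  have hsA := ((psd_iff A).1 hA).1
  have hsB := ((psd_iff B).1 hB).1
  refine ⟨fun i j => by simp [hsA i j, hsB i j], fun v => ?_⟩
  have hm := quad_mono v
    (fun i j t => bothF b α (A i j + t * B i j) - bothF b α (0 + t * B i j)) _
    (fun i j t => (line_deriv b h1 _ _ t).sub (line_deriv b h1 _ _ t)) ?_
  · simp [bothF_zero] at hm
    simp only [Matrix.sub_apply, map_apply, Matrix.add_apply]
    simp only [mul_sub, Finset.sum_sub_distrib] at hm ⊢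
    linarith
  · intro t ht0 ht1
    simp only [← mul_sub]
    apply smul_nonneg_sum v (by linarith)
    have := had_psd hB (mono_all n hn (!b) (α - 1) (by linarith) _ _
      (psd_smul hB ht0.le) hA) v
    simpa [add_comm] using this

lemma super_ge (n : ℕ) (hn : 2 ≤ n) (b : Bool) (α : ℝ) (hα : (n : ℝ) ≤ α) 
    (A B : Matrix (Fin n) (Fin n) ℝ) (hA : A.PosSemidef) (hB : B.PosSemidef) :
    ((A + B).map (bothF b α) - A.map (bothF b α) - B.map (bothF b α)).PosSemidef := by
  have hn' : (2 : ℝ) ≤ n := by exact_mod_cast hn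
  have hcont : ∀ x : ℝ, Continuous fun β => bothF b β x := by
    intro x
    rcases lt_trichotomy x 0 with hx | rfl | hx
    · simp only [bothF_neg b _ hx]
      exact continuous_const.mul (Real.continuous_const_rpow (by linarith))
    · simp only [bothF_zero]; exact continuous_const
    · simp only [bothF_pos b _ hx]
      exact (Real.continuous_const_rpow (by linarith))
  rw [psd_iff]
  have hsA := ((psd_iff A).1 hA).1
  have hsB := ((psd_iff B).1 hB).1
  refine ⟨fun i j => by simp [hsA i j, hsB i j], fun v => ?_⟩
  have hc : Continuous fun β => ∑ i, ∑ j, v i * v j *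
      ((A + B).map (bothF b β) - A.map (bothF b β) - B.map (bothF b β)) i j := by
    refine continuous_finsetSum _ fun i _ => continuous_finsetSum _ fun j _ => ?_
    simp only [Matrix.sub_apply, map_apply]
    exact continuous_const.mul (((hcont _).sub (hcont _)).sub (hcont _))
  have ht := (hc.tendsto α).mono_left (nhdsWithin_le_nhds (s := Set.Ioi α))
  refine ge_of_tendsto ht ?_
  filter_upwards [self_mem_nhdsWithin] with β hβ
  exact ((psd_iff _).1 (super_lt n hn b β (hα.trans_lt hβ) A B hA hB)).2 v

lemma super_nat (n : ℕ) (k : ℕ) (A B : Matrix (Fin n) (Fin n) ℝ)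
    (hA : A.PosSemidef) (hB : B.PosSemidef) :
    (A.map (fun x => x ^ (k + 1))).PosSemidef ∧
    ((A + B).map (fun x => x ^ (k + 1)) - A.map (fun x => x ^ (k + 1))
      - B.map (fun x => x ^ (k + 1))).PosSemidef := by
  have hpow : ∀ (k : ℕ) (A : Matrix (Fin n) (Fin n) ℝ), A.PosSemidef →
      (A.map (fun x => x ^ (k + 1))).PosSemidef := by
    intro k A hA
    induction k with
    | zero => simpa using hA
    | succ k ih =>
      have e : A.map (fun x => x ^ (k + 1 + 1)) = (A.map fun x => x ^ (k + 1)) ⊙ A := by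
        ext i j; simp [pow_succ]
      rw [e]
      exact ih.hadamard hA
  refine ⟨hpow k A hA, ?_⟩
  induction k with
  | zero =>
    convert (PosSemidef.zero : (0 : Matrix (Fin n) (Fin n) ℝ).PosSemidef) using 1
    ext i j; simp
  | succ k ih =>
    have e : (A + B).map (fun x => x ^ (k + 1 + 1)) - A.map (fun x => x ^ (k + 1 + 1))
        - B.map (fun x => x ^ (k + 1 + 1)) =
        (A + B) ⊙ ((A + B).map (fun x => x ^ (k + 1)) - A.map (fun x => x ^ (k + 1))
          - B.map (fun x => x ^ (k + 1))) + B ⊙ A.map (fun x => x ^ (k + 1))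
          + A ⊙ B.map (fun x => x ^ (k + 1)) := by
      ext i j; simp; ring
    rw [e]
    exact (((hA.add hB).hadamard ih).add (hB.hadamard (hpow k A hA))).add
      (hA.hadamard (hpow k B hB))

lemma rank_one_psd {n : ℕ} (u : Fin n → ℝ) {c : ℝ} (hc : 0 ≤ c) :
    (Matrix.of fun i j => c * (u i * u j) : Matrix (Fin n) (Fin n) ℝ).PosSemidef := by
  rw [psd_iff]
  refine ⟨fun i j => by simp only [of_apply]; ring, fun v => ?_⟩
  simp only [of_apply]
  apply smul_nonneg_sum v hc (fun i j => u i * u j)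
  rw [rank_one_sum]
  exact mul_self_nonneg _

lemma binom_taylor (α : ℝ) (m : ℕ) :
    (fun y : ℝ => (1 + y) ^ α - ∑ k ∈ Finset.range (m + 1), Ring.choose α k * y ^ k)
      =O[nhds 0] fun y => y ^ (m + 1) := by
  have h := (Real.one_add_rpow_hasFPowerSeriesAt_zero (a := α)).isBigO_sub_partialSum_pow (m + 1)
  simp only [zero_add, FormalMultilinearSeries.partialSum, binomialSeries_apply, List.ofFn_const,
    List.prod_replicate, smul_eq_mul] at h
  refine h.trans (Asymptotics.isBigO_of_le _ fun y => ?_)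
  simp

lemma pow_littleO {α : ℝ} {m : ℕ} (hα : α < m + 1) :
    (fun e : ℝ => e ^ (m + 1)) =o[nhdsWithin 0 (Set.Ioi 0)] fun e => e ^ α := by
  rw [Asymptotics.isLittleO_iff_tendsto']
  · have h1 : Filter.Tendsto (fun e : ℝ => e ^ ((m : ℝ) + 1 - α))
        (nhdsWithin 0 (Set.Ioi 0)) (nhds 0) := by
      have := (Real.continuousAt_rpow_const 0 ((m : ℝ) + 1 - α) (Or.inr (by linarith))).tendsto
      rw [Real.zero_rpow (by linarith)] at this
      exact this.mono_left nhdsWithin_le_nhds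
    refine h1.congr' ?_
    filter_upwards [self_mem_nhdsWithin] with e he
    rw [Real.rpow_sub he]
    congr 1
    exact_mod_cast Real.rpow_natCast e (m + 1)
  · filter_upwards [self_mem_nhdsWithin] with e he h
    exact absurd h (Real.rpow_pos_of_pos he _).ne'

lemma necessity (n m : ℕ) (hmn : m < n) (b : Bool) (α q : ℝ) (hα : α < m + 1)
    (hq : ∀ k : ℕ, 1 ≤ k → k ≤ m → bothF b α q ≠ q ^ k)
    (H : ∀ A B : Matrix (Fin n) (Fin n) ℝ, A.PosSemidef → B.PosSemidef →
        ((A + B).map (bothF b α) - A.map (bothF b α) - B.map (bothF b α)).PosSemidef) : False := by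
  classical
  set P : Polynomial ℝ := ∏ k ∈ Finset.Icc 1 m, (Polynomial.X - Polynomial.C (q ^ k)) with hP
  have hdeg : P.natDegree < n := by
    rw [hP, Polynomial.natDegree_finsetProd_X_sub_C_eq_card]
    simpa using hmn
  set v : Fin n → ℝ := fun i => P.coeff i with hv
  set u : Fin n → ℝ := fun i => q ^ (i : ℕ) with hu
  have hev : ∀ x : ℝ, ∑ i, v i * x ^ (i : ℕ) = P.eval x := by
    intro x
    rw [Polynomial.eval_eq_sum_range' hdeg, Finset.sum_range]
  have hz : ∀ k : ℕ, 1 ≤ k → k ≤ m → ∑ i, v i * (u i) ^ k = 0 := by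
    intro k h1 h2
    have : ∀ i, u i ^ k = (q ^ k) ^ (i : ℕ) := fun i => by rw [hu, ← pow_mul, ← pow_mul, mul_comm]
    simp only [this]
    rw [hev, hP, Polynomial.eval_prod]
    exact Finset.prod_eq_zero (Finset.mem_Icc.2 ⟨h1, h2⟩) (by simp)
  have hone : bothF b α 1 = 1 := by rw [bothF_pos b α one_pos, Real.one_rpow]
  have hfu : ∀ i, bothF b α (u i) = (bothF b α q) ^ (i : ℕ) := by
    intro i
    simp only [hu]
    induction (i : ℕ) with
    | zero => simpa using hone
    | succ k ih => rw [pow_succ, pow_succ, bothF_mul, ih]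
  set s : ℝ := ∑ i, v i * bothF b α (u i) with hs
  have hs0 : s ≠ 0 := by
    rw [hs]
    simp only [hfu]
    rw [hev, hP, Polynomial.eval_prod, Finset.prod_ne_zero_iff]
    intro k hk
    rw [Finset.mem_Icc] at hk
    simpa [sub_eq_zero] using hq k hk.1 hk.2
  set R : ℝ → ℝ := fun y =>
    (1 + y) ^ α - ∑ k ∈ Finset.range (m + 1), Ring.choose α k * y ^ k with hR
  set h : ℝ → ℝ := fun e => ∑ i, ∑ j, v i * v j * R (e * (u i * u j)) with hh
  have hto : ∀ i j, Filter.Tendsto (fun e : ℝ => e * (u i * u j)) (nhdsWithin 0 (Set.Ioi 0))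
      (nhds 0) := by
    intro i j
    have : Filter.Tendsto (fun e : ℝ => e * (u i * u j)) (nhds 0) (nhds (0 * (u i * u j))) :=
      (continuous_id.mul continuous_const).tendsto 0
    rw [zero_mul] at this
    exact this.mono_left nhdsWithin_le_nhds
  have hO : h =o[nhdsWithin 0 (Set.Ioi 0)] fun e : ℝ => e ^ α := by
    rw [hh]
    refine Asymptotics.IsLittleO.fun_sum fun i _ => Asymptotics.IsLittleO.fun_sum fun j _ => ?_
    apply Asymptotics.IsLittleO.const_mul_left
    refine Asymptotics.IsBigO.trans_isLittleO ?_ (pow_littleO hα)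
    refine ((binom_taylor α m).comp_tendsto (hto i j)).trans ?_
    have e1 : (fun y : ℝ => y ^ (m + 1)) ∘ (fun e : ℝ => e * (u i * u j))
        = fun e : ℝ => (u i * u j) ^ (m + 1) * e ^ (m + 1) := by
      funext e; simp only [Function.comp_apply]; rw [mul_pow, mul_comm]
    rw [e1]
    exact Asymptotics.isBigO_const_mul_self _ _ _
  have hlow : ∀ᶠ e in nhdsWithin (0 : ℝ) (Set.Ioi 0), e ^ α * (s * s) ≤ h e := by
    have hp : ∀ᶠ e in nhdsWithin (0 : ℝ) (Set.Ioi 0), ∀ i j, 0 < 1 + e * (u i * u j) := by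
      rw [Filter.eventually_all]; intro i
      rw [Filter.eventually_all]; intro j
      filter_upwards [(hto i j).eventually (lt_mem_nhds (by norm_num : (-1 : ℝ) < 0))] with e he
      linarith
    filter_upwards [hp, self_mem_nhdsWithin] with e hp he
    have he : 0 < e := he
    have hpsd := ((psd_iff _).1 (H _ _ (rank_one_psd (fun _ : Fin n => (1 : ℝ)) zero_le_one)
      (rank_one_psd u he.le))).2 v
    have hpoly : ∑ i, ∑ j, v i * v j *
        ∑ k ∈ Finset.range (m + 1), Ring.choose α k * (e * (u i * u j)) ^ k
        = ∑ i, ∑ j, v i * v j * 1 := by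
      have hk : ∀ k ∈ Finset.range m, ∑ i, ∑ j, v i * v j *
          (Ring.choose α (k + 1) * (e * (u i * u j)) ^ (k + 1)) = 0 := by
        intro k hk
        rw [Finset.mem_range] at hk
        have := rank_one_sum v (fun i => u i ^ (k + 1)) (fun i => u i ^ (k + 1))
        rw [hz (k + 1) (by omega) (by omega), zero_mul] at this
        have e1 : ∑ i, ∑ j, v i * v j *
          (Ring.choose α (k + 1) * (e * (u i * u j)) ^ (k + 1)) =
          Ring.choose α (k + 1) * e ^ (k + 1) *
            ∑ i, ∑ j, v i * v j * (u i ^ (k + 1) * u j ^ (k + 1)) := by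
          simp only [Finset.mul_sum]
          exact Finset.sum_congr rfl fun i _ => Finset.sum_congr rfl fun j _ => by ring
        rw [e1, this, mul_zero]
      have e2 : ∀ i j, v i * v j *
          ∑ k ∈ Finset.range (m + 1), Ring.choose α k * (e * (u i * u j)) ^ k
          = v i * v j * 1 + ∑ k ∈ Finset.range m, v i * v j *
            (Ring.choose α (k + 1) * (e * (u i * u j)) ^ (k + 1)) := by
        intro i j
        rw [Finset.sum_range_succ', mul_add, Finset.mul_sum]
        simp [add_comm]
      simp only [e2, Finset.sum_add_distrib]
      rw [add_eq_left]
      rw [← Finset.sum_eq_zero hk, Finset.sum_comm]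
      have : ∀ i, ∑ j, ∑ k ∈ Finset.range m, v i * v j *
            (Ring.choose α (k + 1) * (e * (u i * u j)) ^ (k + 1)) =
            ∑ k ∈ Finset.range m, ∑ j, v i * v j *
            (Ring.choose α (k + 1) * (e * (u i * u j)) ^ (k + 1)) := fun i => Finset.sum_comm
      rw [Finset.sum_comm]
      simp only [this]
      rw [Finset.sum_comm]
    have hB : ∑ i, ∑ j, v i * v j * bothF b α (e * (u i * u j)) = e ^ α * (s * s) := by
      rw [hs, ← rank_one_sum]
      simp only [Finset.mul_sum]
      refine Finset.sum_congr rfl fun i _ => Finset.sum_congr rfl fun j _ => ?_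
      rw [bothF_mul, bothF_mul, bothF_pos b α he]; ring
    have hA : ∑ i, ∑ j, v i * v j * bothF b α (1 + e * (u i * u j))
        = ∑ i, ∑ j, v i * v j * (1 + e * (u i * u j)) ^ α := by
      refine Finset.sum_congr rfl fun i _ => Finset.sum_congr rfl fun j _ => ?_
      rw [bothF_pos b α (hp i j)]
    simp only [Matrix.sub_apply, map_apply, Matrix.add_apply, of_apply, mul_one, hone] at hpsd
    simp only [hh, hR]
    simp only [mul_sub, Finset.sum_sub_distrib, hB, hA, mul_one] at hpsd hpoly ⊢
    linarith
  have hc : 0 < s * s := mul_self_pos.2 hs0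
  have hup := hO.def (half_pos hc)
  obtain ⟨e, h1, h2, he⟩ := (hlow.and (hup.and self_mem_nhdsWithin)).exists
  have hpos : 0 < e ^ α := Real.rpow_pos_of_pos he _
  rw [Real.norm_eq_abs, Real.norm_of_nonneg hpos.le] at h2
  nlinarith [le_abs_self (h e)]

lemma bothF_lt_one (n : ℕ) (hn : 2 ≤ n) (b : Bool) (α : ℝ)
    (H : ∀ A B : Matrix (Fin n) (Fin n) ℝ, A.PosSemidef → B.PosSemidef →
        ((A + B).map (bothF b α) - A.map (bothF b α) - B.map (bothF b α)).PosSemidef) :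
    1 ≤ α := by
  by_contra! hlt
  have h1 := rank_one_psd (fun _ : Fin n => (1 : ℝ)) zero_le_one
  have h := (H _ _ h1 h1).diag_nonneg (i := ⟨0, by omega⟩)
  simp only [Matrix.sub_apply, map_apply, Matrix.add_apply, of_apply, mul_one,
    bothF_pos b α one_pos, Real.one_rpow] at h
  rw [bothF_pos b α (by norm_num)] at h
  have : (1 + 1 : ℝ) ^ α < (1 + 1) ^ (1 : ℝ) := Real.rpow_lt_rpow_of_exponent_lt (by norm_num) hlt
  rw [Real.rpow_one] at this
  linarith

lemma nec_final (n : ℕ) (hn : 2 ≤ n) (b : Bool) (α : ℝ)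
    (H : ∀ A B : Matrix (Fin n) (Fin n) ℝ, A.PosSemidef → B.PosSemidef →
        ((A + B).map (bothF b α) - A.map (bothF b α) - B.map (bothF b α)).PosSemidef)
    (hα : α < n) : ∃ k : ℕ, 1 ≤ k ∧ α = k ∧ sgB b = (-1) ^ k := by
  by_contra! hno
  have h1 := bothF_lt_one n hn b α H
  have hfl : ⌊α⌋₊ < n := (Nat.floor_lt (by linarith)).2 hα
  refine necessity n ⌊α⌋₊ hfl b α (-2) (Nat.lt_floor_add_one α) ?_ H
  intro k hk1 _ heq
  rw [bothF_neg b α (by norm_num), neg_neg] at heq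
  have hpos : (0 : ℝ) < 2 ^ α := by positivity
  have e2 : (2 : ℝ) ^ α = 2 ^ (k : ℝ) := by
    have := congrArg abs heq
    rw [abs_mul, abs_of_pos hpos, abs_pow] at this
    have hs1 : |sgB b| = 1 := by cases b <;> simp [sgB]
    rw [hs1] at this
    simpa using this
  have e3 : α = k := by
    exact (Real.rpow_right_inj (by norm_num) (by norm_num)).1 e2
  apply hno k hk1 e3
  rw [e2, Real.rpow_natCast, neg_pow] at heq
  exact mul_right_cancel₀ (by positivity) heq

lemma bothF_nat (b : Bool) (k : ℕ) (hk : 1 ≤ k) (hb : sgB b = (-1) ^ k) :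
    bothF b (k : ℝ) = fun x => x ^ k := by
  funext x
  rcases lt_trichotomy x 0 with hx | rfl | hx
  · rw [bothF_neg b _ hx, Real.rpow_natCast, hb, ← mul_pow]; simp
  · rw [bothF_zero, zero_pow (by omega)]
  · rw [bothF_pos b _ hx, Real.rpow_natCast]

lemma main_set (n : ℕ) (hn : 2 ≤ n) (b : Bool) (α : ℝ) :
    (∀ A B : Matrix (Fin n) (Fin n) ℝ, A.PosSemidef → B.PosSemidef →
        ((A + B).map (bothF b α) - A.map (bothF b α) - B.map (bothF b α)).PosSemidef) ↔
    ((∃ k : ℕ, 1 ≤ k ∧ α = k ∧ sgB b = (-1) ^ k) ∨ (n : ℝ) ≤ α) := by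
  constructor
  · intro H
    by_cases h : (n : ℝ) ≤ α
    · exact Or.inr h
    · exact Or.inl (nec_final n hn b α H (not_le.1 h))
  · rintro (⟨k, hk, rfl, hb⟩ | h) A B hA hB
    · rw [bothF_nat b k hk hb]
      obtain ⟨k, rfl⟩ : ∃ l, k = l + 1 := ⟨k - 1, by omega⟩
      exact (super_nat n k A B hA hB).2
    · exact super_ge n hn b α h A B hA hB

/-- The powers `α` for which `ψ_α[-]` (resp. `φ_α[-]`) is Loewner super-additive on
`P_n(ℝ)` are exactly the odd (resp. even) positive integers together with `[n, ∞)`. -/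
theorem stmt12 (n : ℕ) (hn : 2 ≤ n) :
    ({α : ℝ | ∀ A B : Matrix (Fin n) (Fin n) ℝ, A.PosSemidef → B.PosSemidef →
        ((A + B).map (psiF α) - A.map (psiF α) - B.map (psiF α)).PosSemidef}
      = {α : ℝ | ∃ k : ℕ, Odd k ∧ α = k} ∪ Set.Ici (n : ℝ)) ∧
    ({α : ℝ | ∀ A B : Matrix (Fin n) (Fin n) ℝ, A.PosSemidef → B.PosSemidef →
        ((A + B).map (phiF α) - A.map (phiF α) - B.map (phiF α)).PosSemidef}
      = {α : ℝ | ∃ k : ℕ, Even k ∧ 0 < k ∧ α = k} ∪ Set.Ici (n : ℝ)) := by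
  constructor
  · ext α
    have h := main_set n hn true α
    have e : bothF true α = psiF α := by funext x; simp [bothF]
    rw [e] at h
    simp only [Set.mem_ofPred_eq, Set.mem_union, Set.mem_Ici]
    rw [h]
    refine or_congr (exists_congr fun k => ?_) Iff.rfl
    constructor
    · rintro ⟨_, h2, h3⟩
      refine ⟨?_, h2⟩
      by_contra hk
      rw [Nat.not_odd_iff_even] at hk
      rw [hk.neg_one_pow] at h3
      norm_num [sgB] at h3
    · rintro ⟨h1, h2⟩
      exact ⟨h1.pos, h2, by simp [sgB, h1.neg_one_pow]⟩
  · ext α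
    have h := main_set n hn false α
    have e : bothF false α = phiF α := by funext x; simp [bothF]
    rw [e] at h
    simp only [Set.mem_ofPred_eq, Set.mem_union, Set.mem_Ici]
    rw [h]
    refine or_congr (exists_congr fun k => ?_) Iff.rfl
    constructor
    · rintro ⟨h1, h2, h3⟩
      refine ⟨?_, h1, h2⟩
      by_contra hk
      rw [Nat.not_even_iff_odd] at hk
      rw [hk.neg_one_pow] at h3
      norm_num [sgB] at h3
    · rintro ⟨h1, h2, h3⟩
      exact ⟨h2, h3, by simp [sgB, h1.neg_one_pow]⟩
end

section
/- Let C_n denote the cycle graph on n ≥ 3 vertices. Then H_{C_n} = [1, ∞) and H_{C_n}^ψ = [1, ∞). -/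
open Matrix

/-- `P_G(I)`: symmetric positive semidefinite matrices with entries in `I`, vanishing at
off-diagonal positions corresponding to non-edges of `G`. -/
def PG {V : Type*} [Fintype V] (G : SimpleGraph V) (I : Set ℝ) : Set (Matrix V V ℝ) :=
  {M | M.PosSemidef ∧ (∀ i j, M i j ∈ I) ∧ ∀ i j, i ≠ j → ¬ G.Adj i j → M i j = 0}

/-- `H_G`: powers `α` such that `A ↦ A^{∘α}` maps `P_G([0,∞))` into `P_G(ℝ)`. -/
noncomputable def HSet {V : Type*} [Fintype V] (G : SimpleGraph V) : Set ℝ :=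
  {α | ∀ A ∈ PG G (Set.Ici 0), A.map (powF α) ∈ PG G Set.univ}

/-- `H_G^ψ`: powers `α` such that `ψ_α[-]` maps `P_G(ℝ)` into `P_G(ℝ)`. -/
noncomputable def HSetPsi {V : Type*} [Fintype V] (G : SimpleGraph V) : Set ℝ :=
  {α | ∀ A ∈ PG G Set.univ, A.map (psiF α) ∈ PG G Set.univ}

/-- `H_G^φ`: powers `α` such that `φ_α[-]` maps `P_G(ℝ)` into `P_G(ℝ)`. -/
noncomputable def HSetPhi {V : Type*} [Fintype V] (G : SimpleGraph V) : Set ℝ :=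
  {α | ∀ A ∈ PG G Set.univ, A.map (phiF α) ∈ PG G Set.univ}

/-- A graph is chordal if every cycle of length at least 4 has a chord, i.e. an edge of `G`
joining two vertices of the cycle that is not an edge of the cycle. -/
def IsChordalG {V : Type*} (G : SimpleGraph V) : Prop :=
  ∀ ⦃v : V⦄ (w : G.Walk v v), w.IsCycle → 4 ≤ w.length →
    ∃ i j : V, i ∈ w.support ∧ j ∈ w.support ∧ G.Adj i j ∧ ¬ w.toSubgraph.Adj i j

lemma psi_of_nonneg {α : ℝ} (hα : 1 ≤ α) {x : ℝ} (hx : 0 ≤ x) : psiF α x = x ^ α := by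
  unfold psiF
  split_ifs with h
  · rw [h, Real.zero_rpow (by linarith)]
  · have : 0 < x := lt_of_le_of_ne hx (Ne.symm h)
    rw [Real.sign_of_pos this, abs_of_pos this, one_mul]

lemma psi_of_nonpos {α : ℝ} (hα : 1 ≤ α) {x : ℝ} (hx : x ≤ 0) : psiF α x = -(-x) ^ α := by
  unfold psiF
  split_ifs with h
  · rw [h, neg_zero, Real.zero_rpow (by linarith), neg_zero]
  · have : x < 0 := lt_of_le_of_ne hx h
    rw [Real.sign_of_neg this, abs_of_neg this, neg_one_mul]

lemma psi_neg (α x : ℝ) : psiF α (-x) = -psiF α x := by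
  unfold psiF
  by_cases h : x = 0 <;> simp [h, Real.sign_neg]

lemma sign_mul' (x y : ℝ) : Real.sign (x * y) = Real.sign x * Real.sign y := by
  rcases lt_trichotomy x 0 with hx | hx | hx <;> rcases lt_trichotomy y 0 with hy | hy | hy
  · rw [Real.sign_of_neg hx, Real.sign_of_neg hy, Real.sign_of_pos (mul_pos_of_neg_of_neg hx hy)]; norm_num
  · simp [hy]
  · rw [Real.sign_of_neg hx, Real.sign_of_pos hy, Real.sign_of_neg (mul_neg_of_neg_of_pos hx hy)]; norm_num
  · simp [hx]
  · simp [hx]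
  · simp [hx]
  · rw [Real.sign_of_pos hx, Real.sign_of_neg hy, Real.sign_of_neg (mul_neg_of_pos_of_neg hx hy)]; norm_num
  · simp [hy]
  · rw [Real.sign_of_pos hx, Real.sign_of_pos hy, Real.sign_of_pos (mul_pos hx hy)]; norm_num

lemma psi_mul (α x y : ℝ) : psiF α (x * y) = psiF α x * psiF α y := by
  unfold psiF
  by_cases hx : x = 0
  · simp [hx]
  by_cases hy : y = 0
  · simp [hy]
  simp only [hx, hy, mul_eq_zero, or_self, if_false]
  rw [sign_mul', abs_mul, Real.mul_rpow (abs_nonneg _) (abs_nonneg _)]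
  ring

lemma psi_zero (α : ℝ) : psiF α 0 = 0 := by simp [psiF]

lemma psi_pos {α b : ℝ} (hb : 0 < b) : 0 < psiF α b := by
  unfold psiF
  rw [if_neg hb.ne', Real.sign_of_pos hb, abs_of_pos hb, one_mul]
  exact Real.rpow_pos_of_pos hb _

lemma psi_div (α x : ℝ) {b : ℝ} (hb : 0 < b) : psiF α (x / b) = psiF α x / psiF α b := by
  rw [eq_div_iff (psi_pos hb).ne', ← psi_mul, div_mul_cancel₀ _ hb.ne']

lemma psi_hasDerivAt {α : ℝ} (hα : 1 ≤ α) (x : ℝ) :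
    HasDerivAt (psiF α) (α * |x| ^ (α - 1)) x := by
  have hR : ∀ z : ℝ, HasDerivAt (fun x : ℝ => x ^ α) (α * z ^ (α - 1)) z := fun z =>
    Real.hasDerivAt_rpow_const (Or.inr hα)
  have hL : ∀ z : ℝ, HasDerivAt (fun x : ℝ => -(-x) ^ α) (α * (-z) ^ (α - 1)) z := fun z => by
    have := ((hR (-z)).comp z (hasDerivAt_neg z)).neg
    refine this.congr_deriv ?_
    ring
  rcases lt_trichotomy x 0 with hx | hx | hx
  · rw [abs_of_neg hx]
    refine (hL x).congr_of_eventuallyEq ?_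
    filter_upwards [Iio_mem_nhds hx] with z hz
    exact psi_of_nonpos hα (le_of_lt hz)
  · subst hx
    have h1 : HasDerivWithinAt (psiF α) (α * |(0:ℝ)| ^ (α - 1)) (Set.Ici 0) 0 := by
      rw [abs_zero]
      refine (hR 0).hasDerivWithinAt.congr (fun z hz => psi_of_nonneg hα hz) (psi_of_nonneg hα le_rfl)
    have h2 : HasDerivWithinAt (psiF α) (α * |(0:ℝ)| ^ (α - 1)) (Set.Iic 0) 0 := by
      have := hL 0
      rw [neg_zero] at this
      rw [abs_zero]
      refine this.hasDerivWithinAt.congr (fun z hz => psi_of_nonpos hα hz) (psi_of_nonpos hα le_rfl)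
    have := h2.union h1
    rwa [Set.Iic_union_Ici, hasDerivWithinAt_univ] at this
  · rw [abs_of_pos hx]
    refine (hR x).congr_of_eventuallyEq ?_
    filter_upwards [Ioi_mem_nhds hx] with z hz
    exact psi_of_nonneg hα (le_of_lt hz)

lemma form_disc {p x r : ℝ} (h : ∀ u v : ℝ, 0 ≤ p * u ^ 2 + 2 * x * u * v + r * v ^ 2) :
    0 ≤ p ∧ 0 ≤ r ∧ x ^ 2 ≤ p * r := by
  have hp := h 1 0
  have hr := h 0 1
  norm_num at hp hr
  refine ⟨hp, hr, ?_⟩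
  rcases hp.eq_or_lt with h0 | h0
  · have h1 := h (-(r + 1) * x) (1)
    have h2 := h (-(r+1)*x) 1
    rw [← h0] at h2
    have : 0 ≤ r - 2 * (r + 1) * x ^ 2 := by nlinarith
    rw [← h0]
    by_contra hc
    have hx : 0 < x ^ 2 := by linarith
    have h3 := h (-(r+1)/x) 1
    have hx0 : x ≠ 0 := by rintro rfl; norm_num at hx
    rw [← h0] at h3
    have : 2 * x * (-(r+1)/x) = -2 * (r+1) := by field_simp
    nlinarith
  · have h1 := h (-x) p
    have : 0 ≤ p * (p * r - x ^ 2) := by nlinarith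
    nlinarith [nonneg_of_mul_nonneg_right this h0]

/-- Monotonicity of `ψ_α[-]` on 2x2 positive semidefinite matrices. -/
lemma mono_two {α : ℝ} (hα : 1 ≤ α) {p q r s x y : ℝ}
    (hB : ∀ u v : ℝ, 0 ≤ q * u ^ 2 + 2 * y * u * v + s * v ^ 2)
    (hD : ∀ u v : ℝ, 0 ≤ (p - q) * u ^ 2 + 2 * (x - y) * u * v + (r - s) * v ^ 2) (u v : ℝ) :
    0 ≤ (psiF α p - psiF α q) * u ^ 2 + 2 * (psiF α x - psiF α y) * u * v
      + (psiF α r - psiF α s) * v ^ 2 := by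
  set F : ℝ → ℝ := fun t => psiF α (q + t * (p - q)) * u ^ 2
    + psiF α (y + t * (x - y)) * (2 * u * v) + psiF α (s + t * (r - s)) * v ^ 2 with hF
  have hlin : ∀ a d t : ℝ, HasDerivAt (fun t => psiF α (a + t * d))
      (α * |a + t * d| ^ (α - 1) * d) t := fun a d t => by
    have h1 : HasDerivAt (fun t : ℝ => a + t * d) d t := by
      simpa using ((hasDerivAt_id t).mul_const d).const_add a
    exact (psi_hasDerivAt hα _).comp t h1
  have hder : ∀ t, HasDerivAt F (α * |q + t * (p - q)| ^ (α - 1) * (p - q) * u ^ 2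
      + α * |y + t * (x - y)| ^ (α - 1) * (x - y) * (2 * u * v)
      + α * |s + t * (r - s)| ^ (α - 1) * (r - s) * v ^ 2) t := fun t =>
    (((hlin q (p - q) t).mul_const _).add ((hlin y (x - y) t).mul_const _)).add
      ((hlin s (r - s) t).mul_const _)
  have hmono : MonotoneOn F (Set.Icc 0 1) := by
    refine monotoneOn_of_deriv_nonneg (convex_Icc 0 1)
      (fun t _ => (hder t).continuousAt.continuousWithinAt)
      (fun t _ => (hder t).differentiableAt.differentiableWithinAt) ?_
    intro t ht
    rw [interior_Icc] at ht
    rw [(hder t).deriv]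
    have hT : ∀ u v : ℝ, 0 ≤ (q + t * (p - q)) * u ^ 2 + 2 * (y + t * (x - y)) * u * v
        + (s + t * (r - s)) * v ^ 2 := fun u v => by
      have := hB u v
      have := mul_nonneg ht.1.le (hD u v)
      nlinarith
    obtain ⟨hP, hR, hX⟩ := form_disc hT
    set P := q + t * (p - q)
    set R := s + t * (r - s)
    set X := y + t * (x - y)
    rw [abs_of_nonneg hP, abs_of_nonneg hR]
    have hβ : 0 ≤ α - 1 := by linarith
    set m := (√P) ^ (α - 1) with hm
    set k := (√R) ^ (α - 1) with hk
    have hPm : P ^ (α - 1) = m ^ 2 := by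
      rw [hm, pow_two, ← Real.mul_rpow (Real.sqrt_nonneg _) (Real.sqrt_nonneg _),
        Real.mul_self_sqrt hP]
    have hRk : R ^ (α - 1) = k ^ 2 := by
      rw [hk, pow_two, ← Real.mul_rpow (Real.sqrt_nonneg _) (Real.sqrt_nonneg _),
        Real.mul_self_sqrt hR]
    have hw : |X| ^ (α - 1) ≤ m * k := by
      rw [hm, hk, ← Real.mul_rpow (Real.sqrt_nonneg _) (Real.sqrt_nonneg _)]
      refine Real.rpow_le_rpow (abs_nonneg _) ?_ hβ
      rw [← Real.sqrt_mul hP]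
      exact Real.abs_le_sqrt hX
    have hw0 : 0 ≤ |X| ^ (α - 1) := Real.rpow_nonneg (abs_nonneg _) _
    rw [hPm, hRk]
    set w := |X| ^ (α - 1)
    have h1 := hD (u * m) (v * k)
    have h2 := hD (u * m) (-(v * k))
    have hN : |2 * (x - y) * u * v| * (m * k) ≤
        (p - q) * (u * m) ^ 2 + (r - s) * (v * k) ^ 2 := by
      rcases abs_cases (2 * (x - y) * u * v) with ⟨h, _⟩ | ⟨h, _⟩ <;> rw [h] <;> nlinarith
    have h3 : -(|2 * (x - y) * u * v| * (m * k)) ≤ 2 * (x - y) * u * v * w := by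
      have := neg_abs_le (2 * (x - y) * u * v)
      have h4 := mul_le_mul_of_nonneg_right this hw0
      have h5 := mul_le_mul_of_nonneg_left hw (abs_nonneg (2 * (x - y) * u * v))
      linarith
    have : 0 ≤ α * (((p - q) * (u * m) ^ 2 + (r - s) * (v * k) ^ 2) + 2 * (x - y) * u * v * w) :=
      mul_nonneg (by linarith) (by linarith)
    linarith
  have := hmono (Set.left_mem_Icc.2 zero_le_one) (Set.right_mem_Icc.2 zero_le_one) zero_le_one
  simp only [hF, zero_mul, add_zero, one_mul, add_sub_cancel] at this
  linarith

/-- Path part of the quadratic form. -/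
noncomputable def SS (d e : ℕ → ℝ) (k : ℕ) (x : ℕ → ℝ) : ℝ :=
  ∑ i ∈ Finset.range k, (2 * e i * x i * x (i + 1) + d i * x (i + 1) ^ 2)

/-- Quadratic form of a cycle on vertices `0,…,k+1`. -/
noncomputable def QQ (d e : ℕ → ℝ) (k : ℕ) (a b c : ℝ) (x : ℕ → ℝ) (y : ℝ) : ℝ :=
  SS d e k x + 2 * e k * x k * y + b * y ^ 2 + 2 * c * x 0 * y + a * x 0 ^ 2

lemma SS_congr (d e : ℕ → ℝ) (k : ℕ) {x x' : ℕ → ℝ} (h : ∀ i ≤ k, x i = x' i) :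
    SS d e k x = SS d e k x' := by
  unfold SS
  refine Finset.sum_congr rfl fun i hi => ?_
  rw [Finset.mem_range] at hi
  rw [h i hi.le, h (i + 1) hi]

lemma SS_zero (d e : ℕ → ℝ) (k : ℕ) : SS d e k (fun _ => 0) = 0 := by simp [SS]

lemma SS_single (d e : ℕ → ℝ) (k : ℕ) (t : ℝ) :
    SS d e k (fun i => if i = 0 then t else 0) = 0 := by simp [SS]

lemma super {α u w : ℝ} (hα : 1 ≤ α) (hw : 0 ≤ w) (hu : 0 ≤ u - w) :
    psiF α (u - w) + psiF α w ≤ psiF α u := by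
  rw [psi_of_nonneg hα hw, psi_of_nonneg hα hu, psi_of_nonneg hα (by linarith : 0 ≤ u)]
  have := Real.add_rpow_le_rpow_add hu hw hα
  rwa [sub_add_cancel] at this

lemma b_nonneg {d e : ℕ → ℝ} {k : ℕ} {a b c : ℝ} (h : ∀ x y, 0 ≤ QQ d e k a b c x y) : 0 ≤ b := by
  simpa [QQ, SS_zero] using h (fun _ => 0) 1

lemma a_nonneg {d e : ℕ → ℝ} {k : ℕ} {a b c : ℝ} (h : ∀ x y, 0 ≤ QQ d e k a b c x y) : 0 ≤ a := by
  simpa [QQ, SS_single] using h (fun i => if i = 0 then 1 else 0) 0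

lemma lin_zero {s l : ℝ} (h : ∀ y : ℝ, 0 ≤ s + l * y) : l = 0 := by
  by_contra hl
  have := h (-(s + 1) / l)
  rw [mul_div_cancel₀ _ hl] at this
  linarith

lemma ec_zero {d e : ℕ → ℝ} {k : ℕ} {a c : ℝ} (h : ∀ x y, 0 ≤ QQ d e (k + 1) a 0 c x y) :
    e (k + 1) = 0 ∧ c = 0 := by
  have key : ∀ x : ℕ → ℝ, 2 * e (k + 1) * x (k + 1) + 2 * c * x 0 = 0 := fun x =>
    lin_zero (s := SS d e (k + 1) x + a * x 0 ^ 2) fun y => by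
      have := h x y
      unfold QQ at this
      linarith
  have h1 := key (fun i => if i = 0 then 1 else 0)
  have h2 := key (fun i => if i = 0 then 0 else 1)
  simp at h1 h2
  exact ⟨h2, h1⟩

/-- Elimination of the last vertex. -/
lemma elim {d e : ℕ → ℝ} {k : ℕ} {a b c : ℝ} (h : ∀ x y, 0 ≤ QQ d e (k + 1) a b c x y)
    (x : ℕ → ℝ) :
    0 ≤ SS d e k x + 2 * e k * x k * x (k + 1) + (d k - e (k + 1) ^ 2 / b) * x (k + 1) ^ 2
      + 2 * (-(c * e (k + 1) / b)) * x 0 * x (k + 1) + (a - c ^ 2 / b) * x 0 ^ 2 := by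
  have h1 := h x (-(e (k + 1) * x (k + 1) + c * x 0) / b)
  unfold QQ at h1
  have hS : SS d e (k + 1) x = SS d e k x + (2 * e k * x k * x (k + 1) + d k * x (k + 1) ^ 2) := by
    simp [SS, Finset.sum_range_succ]
  rw [hS] at h1
  rcases (b_nonneg h).eq_or_lt with hb | hb
  · rw [← hb] at h1 ⊢
    simp only [div_zero] at h1 ⊢
    linarith
  · refine le_of_le_of_eq h1 ?_
    field_simp
    ring

lemma reassemble {d e : ℕ → ℝ} {k : ℕ} {a b c : ℝ} {α : ℝ}
    (h : ∀ x y, 0 ≤ QQ d e (k + 1) a b c x y) {x : ℕ → ℝ} {y : ℝ}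
    (hx : 0 ≤ SS (fun i => psiF α (d i)) (fun i => psiF α (e i)) k x
      + 2 * psiF α (e k) * x k * x (k + 1)
      + (psiF α (d k) - psiF α (e (k + 1) ^ 2 / b)) * x (k + 1) ^ 2
      + 2 * (-psiF α (c * e (k + 1) / b)) * x 0 * x (k + 1)
      + (psiF α a - psiF α (c ^ 2 / b)) * x 0 ^ 2) :
    0 ≤ QQ (fun i => psiF α (d i)) (fun i => psiF α (e i)) (k + 1)
      (psiF α a) (psiF α b) (psiF α c) x y := by
  unfold QQ
  have hS : SS (fun i => psiF α (d i)) (fun i => psiF α (e i)) (k + 1) x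
      = SS (fun i => psiF α (d i)) (fun i => psiF α (e i)) k x
      + (2 * psiF α (e k) * x k * x (k + 1) + psiF α (d k) * x (k + 1) ^ 2) := by
    simp [SS, Finset.sum_range_succ]
  rw [hS]
  rcases (b_nonneg h).eq_or_lt with hb | hb
  · subst hb
    obtain ⟨he, hc⟩ := ec_zero h
    simp only [he, hc, psi_zero, div_zero] at hx ⊢
    linarith
  · have hB := psi_pos (α := α) hb
    simp only [psi_div _ _ hb, pow_two, psi_mul] at hx
    set B := psiF α b
    set C := psiF α c
    set E := psiF α (e (k + 1))
    have hsq : 0 ≤ B * (y + (E * x (k + 1) + C * x 0) / B) ^ 2 := by positivity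
    have := add_nonneg hx hsq
    refine le_of_le_of_eq this ?_
    field_simp
    ring

lemma main_form {α : ℝ} (hα : 1 ≤ α) (d e : ℕ → ℝ) (k : ℕ) : ∀ a b c : ℝ,
    (∀ x y, 0 ≤ QQ d e (k + 1) a b c x y) → ∀ x y,
    0 ≤ QQ (fun i => psiF α (d i)) (fun i => psiF α (e i)) (k + 1)
      (psiF α a) (psiF α b) (psiF α c) x y := by
  induction k with
  | zero =>
    intro a b c h x y
    refine reassemble h ?_
    have hb := b_nonneg h
    have := mono_two hα (p := a) (q := c ^ 2 / b) (r := d 0) (s := e 1 ^ 2 / b)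
      (x := e 0) (y := c * e 1 / b) (fun u v => by
        have : 0 ≤ (c * u + e 1 * v) ^ 2 / b := by positivity
        refine le_of_le_of_eq this ?_
        ring) (fun u v => by
        have := elim h (fun i => if i = 0 then u else v)
        simp [SS] at this
        linarith) (x 0) (x 1)
    simp only [SS, Finset.range_zero, Finset.sum_empty, zero_add]
    linarith
  | succ k ih =>
    intro a b c h x y
    have hb := b_nonneg h
    have h' : ∀ x y, 0 ≤ QQ d e (k + 1) (a - c ^ 2 / b) (d (k + 1) - e (k + 2) ^ 2 / b)
        (-(c * e (k + 2) / b)) x y := fun x y => by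
      have := elim h (Function.update x (k + 2) y)
      have hS : SS d e (k + 1) (Function.update x (k + 2) y) = SS d e (k + 1) x :=
        SS_congr d e (k + 1) fun i hi => Function.update_of_ne (by omega) _ _
      rw [hS] at this
      simpa [QQ, Function.update_of_ne] using this
    have h2 := ih _ _ _ h' x (x (k + 2))
    refine reassemble h ?_
    have ha := super hα (by positivity) (a_nonneg h')
    have hd := super hα (by positivity) (b_nonneg h')
    unfold QQ at h2
    rw [psi_neg] at h2
    have h3 := mul_nonneg (sub_nonneg.2 ha) (sq_nonneg (x 0))
    have h4 := mul_nonneg (sub_nonneg.2 hd) (sq_nonneg (x (k + 2)))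
    simp only [add_assoc, Nat.reduceAdd] at *
    linarith

/-- The vertex `i` of the cycle on `k + 3` vertices. -/
def cs (k i : ℕ) : Fin (k + 3) := Fin.ofNat (k + 3) i

lemma cs_zero (k : ℕ) : cs k 0 = 0 := rfl

lemma cs_succ (k i : ℕ) : cs k i + 1 = cs k (i + 1) := by
  simp [cs, Fin.ext_iff, Fin.val_add]

lemma cs_fin {k : ℕ} (i : Fin (k + 3)) : cs k i.val = i := by
  simp [cs]

lemma qform_cycle {k : ℕ} {A : Matrix (Fin (k + 3)) (Fin (k + 3)) ℝ}
    (hs : ∀ i j, A i j = A j i)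
    (hz : ∀ i j, i ≠ j → ¬ (SimpleGraph.cycleGraph (k + 3)).Adj i j → A i j = 0)
    (x : Fin (k + 3) → ℝ) :
    star x ⬝ᵥ (A *ᵥ x) = ∑ i, (A i i * x i ^ 2 + 2 * A i (i + 1) * x i * x (i + 1)) := by
  have one_ne : (1 : Fin (k + 3)) ≠ 0 := by simp [Fin.ext_iff]
  have two_ne : (1 : Fin (k + 3)) + 1 ≠ 0 := by
    rw [Ne, Fin.ext_iff, Fin.val_add]
    simp [Nat.mod_eq_of_lt]
  have hrow : ∀ i, (A *ᵥ x) i = A i i * x i + A i (i + 1) * x (i + 1) + A i (i - 1) * x (i - 1) := by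
    intro i
    have h1 : i ≠ i + 1 := by simp
    have h2 : i ≠ i - 1 := fun h => by
      have := eq_sub_iff_add_eq.1 h; simp at this
    have h3 : i + 1 ≠ i - 1 := fun h => by
      have := eq_sub_iff_add_eq.1 h
      rw [add_assoc] at this
      exact two_ne (by simpa using this)
    simp only [mulVec, dotProduct]
    rw [← Finset.sum_subset (Finset.subset_univ {i, i + 1, i - 1})]
    · rw [Finset.sum_insert (by simp [h1, h2]), Finset.sum_insert (by simp [h3]),
        Finset.sum_singleton]
      ring
    · intro j _ hj
      simp only [Finset.mem_insert, Finset.mem_singleton, not_or] at hj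
      rw [hz i j (Ne.symm hj.1), zero_mul]
      rw [SimpleGraph.cycleGraph_adj]
      rintro (h | h)
      · exact hj.2.2 (by rw [← h]; simp)
      · exact hj.2.1 (by rw [← h]; simp)
  have hre : ∑ i, x i * (A i (i - 1) * x (i - 1)) = ∑ i, x (i + 1) * (A i (i + 1) * x i) := by
    rw [← Equiv.sum_comp (Equiv.addRight (1 : Fin (k + 3)))]
    refine Finset.sum_congr rfl fun i _ => ?_
    simp only [Equiv.coe_addRight, add_sub_cancel_right]
    rw [hs]
  simp only [dotProduct, hrow, Pi.star_apply, star_trivial, mul_add, Finset.sum_add_distrib, hre]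
  rw [add_assoc, ← Finset.sum_add_distrib]
  congr 1
  · exact Finset.sum_congr rfl fun i _ => by ring
  · exact Finset.sum_congr rfl fun i _ => by ring

lemma qform_QQ {k : ℕ} {A : Matrix (Fin (k + 3)) (Fin (k + 3)) ℝ}
    (hs : ∀ i j, A i j = A j i)
    (hz : ∀ i j, i ≠ j → ¬ (SimpleGraph.cycleGraph (k + 3)).Adj i j → A i j = 0)
    (x : Fin (k + 3) → ℝ) :
    star x ⬝ᵥ (A *ᵥ x) = QQ (fun i => A (cs k (i + 1)) (cs k (i + 1)))
      (fun i => A (cs k i) (cs k (i + 1))) (k + 1)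
      (A 0 0) (A (cs k (k + 2)) (cs k (k + 2)))
      (A (cs k (k + 2)) 0) (fun i => x (cs k i))
      (x (cs k (k + 2))) := by
  rw [qform_cycle hs hz]
  have hN : ∀ f : Fin (k + 3) → ℝ, ∑ i, f i = ∑ i ∈ Finset.range (k + 3), f (cs k i) :=
    fun f => by
      rw [Finset.sum_range]
      exact Finset.sum_congr rfl fun i _ => by rw [cs_fin]
  have hlast : (cs k (k + 2)) + 1 = 0 := by
    rw [cs_succ]; simp [cs, Fin.ext_iff]
  rw [Finset.sum_add_distrib, hN, hN, Finset.sum_range_succ']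
  unfold QQ SS
  simp only [Finset.sum_range_succ, Finset.sum_add_distrib, hlast]
  simp only [cs_succ, cs_zero, add_assoc, Nat.reduceAdd]
  ring

lemma psi_mem {k : ℕ} {α : ℝ} (hα : 1 ≤ α) {A : Matrix (Fin (k + 3)) (Fin (k + 3)) ℝ}
    (hA : A ∈ PG (SimpleGraph.cycleGraph (k + 3)) Set.univ) :
    A.map (psiF α) ∈ PG (SimpleGraph.cycleGraph (k + 3)) Set.univ := by
  obtain ⟨hP, -, hz⟩ := hA
  have hs : ∀ i j, A i j = A j i := fun i j => by
    simpa using (hP.isHermitian.apply i j).symm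
  have hs' : ∀ i j, (A.map (psiF α)) i j = (A.map (psiF α)) j i := fun i j => by
    rw [map_apply, map_apply, hs]
  have hz' : ∀ i j, i ≠ j → ¬ (SimpleGraph.cycleGraph (k + 3)).Adj i j →
      (A.map (psiF α)) i j = 0 := fun i j h1 h2 => by
    rw [map_apply, hz i j h1 h2, psi_zero]
  refine ⟨?_, fun _ _ => trivial, hz'⟩
  refine PosSemidef.of_dotProduct_mulVec_nonneg (IsHermitian.ext fun i j => ?_) fun x => ?_
  · rw [star_trivial]; exact hs' j i
  rw [qform_QQ hs' hz']
  refine main_form hα (fun i => A (cs k (i + 1)) (cs k (i + 1)))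
      (fun i => A (cs k i) (cs k (i + 1))) k _ _ _ ?_ _ _
  intro X y
  have h := hP.dotProduct_mulVec_nonneg (fun i => if i.val = k + 2 then y else X i.val)
  rw [qform_QQ hs hz] at h
  refine le_of_le_of_eq h (Eq.symm ?_)
  have hv : ∀ i : ℕ, i ≤ k + 2 → ((cs k i) : ℕ) = i := fun i hi =>
    Nat.mod_eq_of_lt (by omega)
  have hx : ∀ i : ℕ, i ≤ k + 1 → X i = (fun i : ℕ => (if ((cs k i) : ℕ) = k + 2 then y
      else X ((cs k i) : ℕ))) i := fun i hi => by
    simp only [hv i (by omega)]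
    rw [if_neg (by omega)]
  unfold QQ
  rw [SS_congr _ _ (k + 1) hx, hx (k + 1) le_rfl, hx 0 (by omega)]
  simp only [hv (k + 2) le_rfl, if_true]

lemma psi_eq_pow (α : ℝ) {x : ℝ} (hx : 0 ≤ x) : psiF α x = powF α x := by
  unfold psiF powF
  split_ifs with h
  · rfl
  · have : 0 < x := lt_of_le_of_ne hx (Ne.symm h)
    rw [Real.sign_of_pos this, abs_of_pos this, one_mul]

lemma counter {k : ℕ} : ∃ A ∈ PG (SimpleGraph.cycleGraph (k + 3)) (Set.Ici 0),
    ∀ α : ℝ, A.map (powF α) ∈ PG (SimpleGraph.cycleGraph (k + 3)) Set.univ → 1 ≤ α := by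
  have v1 : ((1 : Fin (k + 3)) : ℕ) = 1 := by simp
  have v2 : ((2 : Fin (k + 3)) : ℕ) = 2 := Fin.val_cast_of_lt (n := k + 3) (a := 2) (by omega)
  have h01 : (0 : Fin (k + 3)) ≠ 1 := by simp [Fin.ext_iff]
  have h02 : (0 : Fin (k + 3)) ≠ 2 := by rw [Ne, Fin.ext_iff, v2]; simp
  have h12 : (1 : Fin (k + 3)) ≠ 2 := by rw [Ne, Fin.ext_iff, v2, v1]; simp
  let u : Fin (k + 3) → ℝ := fun i => if i = 0 ∨ i = 1 then 1 else 0
  let w : Fin (k + 3) → ℝ := fun i => if i = 1 ∨ i = 2 then 1 else 0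
  have hu0 : u 0 = 1 := by simp [u]
  have hu1 : u 1 = 1 := by simp [u]
  have hu2 : u 2 = 0 := by simp [u, h02.symm, h12.symm]
  have hw0 : w 0 = 0 := by simp [w, h01, h02]
  have hw1 : w 1 = 1 := by simp [w]
  have hw2 : w 2 = 1 := by simp [w]
  refine ⟨vecMulVec u (star u) + vecMulVec w (star w), ⟨?_, ?_, ?_⟩, ?_⟩
  · exact (posSemidef_vecMulVec_self_star u).add (posSemidef_vecMulVec_self_star w)
  · intro i j
    simp only [Set.mem_Ici, Matrix.add_apply, vecMulVec_apply, star_trivial, u, w]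
    split_ifs <;> norm_num
  · intro i j hij hadj
    rw [SimpleGraph.cycleGraph_adj] at hadj
    have e1 : (2 : Fin (k + 3)) - 1 = 1 := by
      rw [sub_eq_iff_eq_add, Fin.ext_iff, Fin.val_add, v1, v2, Nat.mod_eq_of_lt (by omega)]
    simp only [Matrix.add_apply, vecMulVec_apply, star_trivial, u, w]
    have hA : ¬ ((i = 0 ∨ i = 1) ∧ (j = 0 ∨ j = 1)) := by
      rintro ⟨rfl | rfl, rfl | rfl⟩ <;> simp at hij hadj
    have hB : ¬ ((i = 1 ∨ i = 2) ∧ (j = 1 ∨ j = 2)) := by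
      rintro ⟨rfl | rfl, rfl | rfl⟩ <;> simp [e1] at hij hadj
    have e2 : ∀ (P Q : Prop) [Decidable P] [Decidable Q], ¬ (P ∧ Q) →
        (if P then (1 : ℝ) else 0) * (if Q then 1 else 0) = 0 := fun P Q _ _ h => by
      by_cases hP : P <;> by_cases hQ : Q <;> simp_all
    rw [e2 _ _ hA, e2 _ _ hB, add_zero]
  · intro α h
    set A : Matrix (Fin (k + 3)) (Fin (k + 3)) ℝ :=
      vecMulVec u (star u) + vecMulVec w (star w) with hAdef
    have hh := h.1.dotProduct_mulVec_nonneg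
      (fun i => if i = 0 then 1 else if i = 1 then -1 else if i = 2 then 1 else 0)
    have hsum : ∀ f : Fin (k + 3) → ℝ, (∀ i, i ≠ 0 → i ≠ 1 → i ≠ 2 → f i = 0) →
        ∑ i, f i = f 0 + f 1 + f 2 := fun f hf => by
      rw [← Finset.sum_subset (Finset.subset_univ {0, 1, 2})]
      · rw [Finset.sum_insert (by simp [h01, h02]), Finset.sum_insert (by simp [h12]),
          Finset.sum_singleton]
        ring
      · intro j _ hj
        simp only [Finset.mem_insert, Finset.mem_singleton, not_or] at hj
        exact hf j hj.1 hj.2.1 hj.2.2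
    simp only [dotProduct, mulVec] at hh
    rw [hsum _ (fun i a b c => by simp [a, b, c])] at hh
    rw [hsum _ (fun i a b c => by simp [a, b, c]), hsum _ (fun i a b c => by simp [a, b, c]),
      hsum _ (fun i a b c => by simp [a, b, c])] at hh
    have hAij : ∀ i j, A i j = u i * u j + w i * w j := fun i j => by
      simp [A, vecMulVec_apply]
    simp only [map_apply, hAij, hu0, hu1, hu2, hw0, hw1, hw2, Pi.star_apply, star_trivial,
      h01.symm, h02.symm, h12.symm, if_true, if_false] at hh
    norm_num [powF] at hh
    by_contra hlt
    have := Real.rpow_lt_rpow_of_exponent_lt (x := 2) (by norm_num) (not_le.1 hlt)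
    rw [Real.rpow_one] at this
    linarith

/-- For the cycle graph `C_n` (`n ≥ 3`): `H_{C_n} = [1, ∞)` and `H_{C_n}^ψ = [1, ∞)`. -/
theorem stmt16 (n : ℕ) (hn : 3 ≤ n) :
    HSet (SimpleGraph.cycleGraph n) = Set.Ici 1 ∧
    HSetPsi (SimpleGraph.cycleGraph n) = Set.Ici 1 := by
  obtain ⟨k, rfl⟩ := Nat.exists_eq_add_of_le' hn
  obtain ⟨B, hB, hBα⟩ := counter (k := k)
  have hmap : ∀ α : ℝ, ∀ A ∈ PG (SimpleGraph.cycleGraph (k + 3)) (Set.Ici 0),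
      A.map (powF α) = A.map (psiF α) := fun α A hA => by
    ext i j
    rw [map_apply, map_apply, psi_eq_pow α (hA.2.1 i j)]
  have huniv : ∀ A ∈ PG (SimpleGraph.cycleGraph (k + 3)) (Set.Ici 0),
      A ∈ PG (SimpleGraph.cycleGraph (k + 3)) Set.univ := fun A hA =>
    ⟨hA.1, fun _ _ => trivial, hA.2.2⟩
  constructor
  · ext α
    constructor
    · intro h
      exact hBα α (h B hB)
    · intro h A hA
      rw [hmap α A hA]
      exact psi_mem h (huniv A hA)
  · ext α
    constructor
    · intro h
      refine hBα α ?_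
      rw [hmap α B hB]
      exact h B (huniv B hB)
    · intro h A hA
      exact psi_mem h hA
end

section
/- Let C_n denote the cycle graph on n vertices. Then H_{C_4}^φ = [2, ∞); moreover, for every n > 4 one has [2, ∞) ⊆ H_{C_n}^φ ⊆ [1, ∞), and if n > 4 is even then 1 ∉ H_{C_n}^φ. -/
open Matrix

/-- positive semidefiniteness of a real kernel, elementary form -/
def Psd {V : Type*} [Fintype V] (M : V → V → ℝ) : Prop :=
  (∀ i j, M i j = M j i) ∧ ∀ x : V → ℝ, 0 ≤ ∑ i, ∑ j, x i * M i j * x j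

lemma psd_iff_s17 {V : Type*} [Fintype V] (M : Matrix V V ℝ) : M.PosSemidef ↔ Psd M := by
  rw [posSemidef_iff_dotProduct_mulVec]; unfold Psd
  refine and_congr ?_ ?_
  · constructor
    · intro h i j
      have := h.apply j i
      simpa using this
    · intro h
      ext i j
      simpa using h j i
  · refine forall_congr' fun x => ?_
    simp [dotProduct, mulVec, Finset.mul_sum, mul_assoc]

/-- the signed power -/
noncomputable def ps (β x : ℝ) : ℝ := x * |x| ^ (β - 1)

lemma ps_zero (β : ℝ) : ps β 0 = 0 := by simp [ps]
lemma ps_neg (β x : ℝ) : ps β (-x) = - ps β x := by simp [ps]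
lemma ps_mul (β x y : ℝ) : ps β (x * y) = ps β x * ps β y := by
  simp only [ps, abs_mul]
  rw [Real.mul_rpow (abs_nonneg _) (abs_nonneg _)]; ring
lemma ps_inv (β x : ℝ) : ps β (x⁻¹) = (ps β x)⁻¹ := by
  simp only [ps, abs_inv]
  rw [Real.inv_rpow (abs_nonneg _), mul_inv]
lemma ps_div (β x y : ℝ) : ps β (x / y) = ps β x / ps β y := by
  rw [div_eq_mul_inv, ps_mul, ps_inv, div_eq_mul_inv]
lemma ps_nonneg {β x : ℝ} (hx : 0 ≤ x) : 0 ≤ ps β x := by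
  unfold ps; positivity
lemma ps_of_nonneg {β x : ℝ} (hβ : 1 ≤ β) (hx : 0 ≤ x) : ps β x = x ^ β := by
  unfold ps
  rcases hx.eq_or_lt with rfl | h
  · rw [Real.zero_rpow (by linarith : β ≠ 0)]; simp
  · rw [abs_of_pos h, Real.rpow_sub_one h.ne']; field_simp
lemma ps_eq_zero {β x : ℝ} (h : ps β x = 0) : x = 0 := by
  by_contra hx
  have : 0 < |x| ^ (β - 1) := Real.rpow_pos_of_pos (abs_pos.2 hx) _
  unfold ps at h
  rcases mul_eq_zero.1 h with h | h
  · exact hx h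
  · linarith
lemma ps_super {β a b : ℝ} (hβ : 1 ≤ β) (hb : 0 ≤ b) (hab : b ≤ a) :
    ps β (a - b) ≤ ps β a - ps β b := by
  rw [ps_of_nonneg hβ hb, ps_of_nonneg hβ (hb.trans hab), ps_of_nonneg hβ (sub_nonneg.2 hab)]
  have := Real.add_rpow_le_rpow_add (sub_nonneg.2 hab) hb hβ
  simp only [sub_add_cancel] at this
  linarith

lemma ps_deriv {β : ℝ} (hβ : 1 < β) (x : ℝ) : HasDerivAt (ps β) (β * |x| ^ (β - 1)) x := by
  by_cases hx : x = 0
  · subst hx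
    rw [hasDerivAt_iff_tendsto_slope]
    have h0 : (β * |(0:ℝ)| ^ (β - 1)) = |(0:ℝ)| ^ (β - 1) := by
      rw [abs_zero, Real.zero_rpow (by linarith)]; simp
    rw [h0]
    have hc : Continuous (fun y : ℝ => |y| ^ (β - 1)) :=
      continuous_abs.rpow_const (fun _ => Or.inr (by linarith))
    refine ((hc.tendsto 0).mono_left nhdsWithin_le_nhds).congr' ?_
    filter_upwards [self_mem_nhdsWithin] with y hy
    have hy : y ≠ 0 := hy
    simp only [slope_def_field, ps]
    field_simp
    simp
  · have h1 := (hasDerivAt_id x).mul ((hasDerivAt_abs hx).rpow_const (p := β - 1)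
      (Or.inl (abs_ne_zero.2 hx)))
    refine h1.congr_deriv ?_
    have h2 : x * (SignType.sign x : ℝ) = |x| := self_mul_sign x
    have h3 : |x| ^ (β - 1 - 1) = |x| ^ (β - 1) / |x| := Real.rpow_sub_one (abs_ne_zero.2 hx) _
    rw [h3]
    have hx' := abs_ne_zero.2 hx
    simp only [id]
    calc _ = |x| ^ (β - 1) + (x * (SignType.sign x : ℝ)) * (β - 1) * (|x| ^ (β - 1) / |x|) := by ring
      _ = _ := by rw [h2]; field_simp; ring

lemma form_nonneg {a b d : ℝ} (ha : 0 ≤ a) (hd : 0 ≤ d) (h : b ^ 2 ≤ a * d) (u v : ℝ) :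
    0 ≤ u ^ 2 * a + 2 * (u * v) * b + v ^ 2 * d := by
  have h1 : |b| ≤ √a * √d := by
    rw [← Real.sqrt_mul ha, ← Real.sqrt_sq_eq_abs]; exact Real.sqrt_le_sqrt h
  have h2 : |u * v * b| ≤ |u| * |v| * (√a * √d) := by
    rw [abs_mul, abs_mul]; gcongr
  have h3 := neg_abs_le (u * v * b)
  have := sq_nonneg (|u| * √a - |v| * √d)
  have e1 : (|u| * √a - |v| * √d) ^ 2 = u ^ 2 * a - 2 * (|u| * |v| * (√a * √d)) + v ^ 2 * d := by
    have := Real.sq_sqrt ha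
    have := Real.sq_sqrt hd
    rw [sub_sq, mul_pow, mul_pow, sq_abs, sq_abs, Real.sq_sqrt ha, Real.sq_sqrt hd]; ring
  nlinarith

lemma form_det {a b d : ℝ} (h : ∀ u v : ℝ, 0 ≤ u ^ 2 * a + 2 * (u * v) * b + v ^ 2 * d) :
    0 ≤ a ∧ 0 ≤ d ∧ b ^ 2 ≤ a * d := by
  have ha := h 1 0
  have hd := h 0 1
  simp at ha hd
  refine ⟨ha, hd, ?_⟩
  have := discrim_le_zero (a := a) (b := 2 * b) (c := d) (fun x => by have := h x 1; nlinarith)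
  unfold discrim at this
  nlinarith

lemma path_lemma {β : ℝ} (hβ : 1 ≤ β) {c11 c12 c22 e f g : ℝ} (h1 : 0 ≤ c11) (h2 : 0 ≤ c22)
    (h3 : c12 ^ 2 ≤ c11 * c22) (he : 0 ≤ e) (hg : 0 ≤ g) (hf : f ^ 2 ≤ e * g) (u v : ℝ) :
    0 ≤ u ^ 2 * (ps β (e + c11) - ps β e) + 2 * (u * v) * (ps β (f + c12) - ps β f)
      + v ^ 2 * (ps β (g + c22) - ps β g) := by
  rcases hβ.eq_or_lt with rfl | hβ
  · simp only [ps, sub_self, Real.rpow_zero, mul_one, add_sub_cancel_left]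
    exact form_nonneg h1 h2 h3 u v
  let F : ℝ → ℝ := fun t => u ^ 2 * ps β (e + t * c11) + 2 * (u * v) * ps β (f + t * c12)
      + v ^ 2 * ps β (g + t * c22)
  have hd1 : ∀ a c t : ℝ, HasDerivAt (fun t => ps β (a + t * c)) (β * |a + t * c| ^ (β - 1) * c) t := by
    intro a c t
    have h := ((hasDerivAt_id t).mul_const c).const_add a
    have := (ps_deriv hβ (a + t * c)).comp t h
    simp only [id, one_mul] at this
    exact this
  have hD : ∀ t, HasDerivAt F (u ^ 2 * (β * |e + t * c11| ^ (β - 1) * c11)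
      + 2 * (u * v) * (β * |f + t * c12| ^ (β - 1) * c12)
      + v ^ 2 * (β * |g + t * c22| ^ (β - 1) * c22)) t := fun t =>
    (((hd1 e c11 t).const_mul _).add ((hd1 f c12 t).const_mul _)).add ((hd1 g c22 t).const_mul _)
  have hmono : MonotoneOn F (Set.Icc 0 1) := by
    apply monotoneOn_of_deriv_nonneg (convex_Icc 0 1)
    · exact fun t _ => (hD t).continuousAt.continuousWithinAt
    · exact fun t _ => (hD t).differentiableAt.differentiableWithinAt
    · intro t ht
      rw [interior_Icc] at ht
      rw [(hD t).deriv]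
      have ht0 := ht.1.le
      have hm1 : 0 ≤ e + t * c11 := by positivity
      have hm2 : 0 ≤ g + t * c22 := by positivity
      have hm : (f + t * c12) ^ 2 ≤ (e + t * c11) * (g + t * c22) := by
        apply (form_det _).2.2
        intro x y
        have k1 := form_nonneg he hg hf x y
        have k2 := mul_nonneg ht0 (form_nonneg h1 h2 h3 x y)
        nlinarith
      apply form_nonneg
      · positivity
      · positivity
      · have k : (|f + t * c12| ^ (β - 1)) ^ 2 ≤ |e + t * c11| ^ (β - 1) * |g + t * c22| ^ (β - 1) := by
          rw [← Real.mul_rpow (abs_nonneg _) (abs_nonneg _), sq,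
            ← Real.mul_rpow (abs_nonneg _) (abs_nonneg _)]
          apply Real.rpow_le_rpow (by positivity) _ (by linarith)
          rw [abs_mul_abs_self, ← abs_mul, abs_of_nonneg (mul_nonneg hm1 hm2), ← sq]
          exact hm
        calc _ = β ^ 2 * ((|f + t * c12| ^ (β - 1)) ^ 2 * c12 ^ 2) := by ring
          _ ≤ β ^ 2 * ((|e + t * c11| ^ (β - 1) * |g + t * c22| ^ (β - 1)) * (c11 * c22)) := by
            gcongr
          _ = _ := by ring
  have := hmono (Set.left_mem_Icc.2 zero_le_one) (Set.right_mem_Icc.2 zero_le_one) zero_le_one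
  simp only [F, zero_mul, one_mul, add_zero] at this
  linarith

/-- Schur complement of the first entry -/
noncomputable def schur {n : ℕ} (M : Fin (n + 1) → Fin (n + 1) → ℝ) (i j : Fin n) : ℝ :=
  M i.succ j.succ - M 0 i.succ * M 0 j.succ / M 0 0

lemma quad_split {n : ℕ} (M : Fin (n + 1) → Fin (n + 1) → ℝ) (hs : ∀ i j, M i j = M j i)
    (x : Fin (n + 1) → ℝ) :
    ∑ i, ∑ j, x i * M i j * x j = M 0 0 * x 0 ^ 2 + 2 * x 0 * (∑ j : Fin n, M 0 j.succ * x j.succ)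
      + ∑ i : Fin n, ∑ j : Fin n, x i.succ * M i.succ j.succ * x j.succ := by
  simp only [Fin.sum_univ_succ, Finset.sum_add_distrib]
  have h1 : ∑ i : Fin n, x i.succ * M i.succ 0 * x 0 = x 0 * ∑ j : Fin n, M 0 j.succ * x j.succ := by
    rw [Finset.mul_sum]; refine Finset.sum_congr rfl fun i _ => ?_
    rw [hs i.succ 0]; ring
  have h2 : ∑ i : Fin n, x 0 * M 0 i.succ * x i.succ = x 0 * ∑ j : Fin n, M 0 j.succ * x j.succ := by
    rw [Finset.mul_sum]; refine Finset.sum_congr rfl fun i _ => ?_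
    ring
  rw [h1, h2]; ring

lemma quad_schur {n : ℕ} (M : Fin (n + 1) → Fin (n + 1) → ℝ) (y : Fin n → ℝ) :
    ∑ i, ∑ j, y i * schur M i j * y j =
      (∑ i : Fin n, ∑ j : Fin n, y i * M i.succ j.succ * y j)
        - (∑ j : Fin n, M 0 j.succ * y j) ^ 2 / M 0 0 := by
  rw [sq, Finset.sum_mul_sum, Finset.sum_div, ← Finset.sum_sub_distrib]
  refine Finset.sum_congr rfl fun i _ => ?_
  rw [Finset.sum_div, ← Finset.sum_sub_distrib]
  refine Finset.sum_congr rfl fun j _ => ?_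
  unfold schur; ring

lemma psd_diag {V : Type*} [Fintype V] {M : V → V → ℝ} (h : Psd M) (i : V) : 0 ≤ M i i := by
  classical
  have := h.2 (Pi.single i 1)
  simpa [Pi.single_apply] using this

lemma schur_psd_s17 {n : ℕ} {M : Fin (n + 1) → Fin (n + 1) → ℝ} (h : Psd M) : Psd (schur M) := by
  refine ⟨fun i j => ?_, fun y => ?_⟩
  · unfold schur; rw [h.1 i.succ, mul_comm (M 0 i.succ)]
  · rw [quad_schur]
    by_cases hc : M 0 0 = 0
    · have := h.2 (Fin.cons 0 y)
      rw [quad_split M h.1] at this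
      simpa [hc] using this
    · have := h.2 (Fin.cons (-(∑ j : Fin n, M 0 j.succ * y j) / M 0 0) y)
      rw [quad_split M h.1] at this
      simp only [Fin.cons_zero, Fin.cons_succ] at this
      refine this.trans_eq ?_
      field_simp
      ring

lemma psd_of_schur {n : ℕ} {M : Fin (n + 1) → Fin (n + 1) → ℝ} (hs : ∀ i j, M i j = M j i)
    (h0 : 0 ≤ M 0 0) (hb : M 0 0 = 0 → ∀ j, M 0 j = 0) (h : Psd (schur M)) : Psd M := by
  refine ⟨hs, fun x => ?_⟩
  have h1 := h.2 (fun i => x i.succ)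
  rw [quad_schur] at h1
  rw [quad_split M hs]
  by_cases hc : M 0 0 = 0
  · simp only [hb hc, div_zero, sub_zero] at h1 ⊢
    simpa using h1
  · set s := ∑ j : Fin n, M 0 j.succ * x j.succ
    have h2 : 0 ≤ M 0 0 * (x 0 + s / M 0 0) ^ 2 := by positivity
    have h3 : M 0 0 * (x 0 + s / M 0 0) ^ 2 = M 0 0 * x 0 ^ 2 + 2 * x 0 * s + s ^ 2 / M 0 0 := by
      field_simp
      ring
    linarith

lemma psd_zero {n : ℕ} {M : Fin (n + 1) → Fin (n + 1) → ℝ} (h : Psd M) (hc : M 0 0 = 0) (j) :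
    M 0 j = 0 := by
  refine Fin.cases hc (fun j => ?_) j
  have : ∀ u v : ℝ, 0 ≤ u ^ 2 * M 0 0 + 2 * (u * v) * M 0 j.succ + v ^ 2 * M j.succ j.succ := by
    intro u v
    have := h.2 (Fin.cons u (Pi.single j v))
    rw [quad_split M h.1] at this
    simp [Pi.single_apply] at this
    nlinarith
  have := (form_det this).2.2
  rw [hc] at this
  nlinarith

lemma ps_schur {n : ℕ} (β : ℝ) (M : Fin (n + 1) → Fin (n + 1) → ℝ) (i j : Fin n) :
    schur (fun i j => ps β (M i j)) i j =
      ps β (M i.succ j.succ) - ps β (M 0 i.succ * M 0 j.succ / M 0 0) := by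
  simp only [schur, ps_div, ps_mul]

lemma ps_three {β : ℝ} (hβ : 1 ≤ β) (M : Fin 3 → Fin 3 → ℝ) (h : Psd M) :
    Psd (fun i j => ps β (M i j)) := by
  refine psd_of_schur (fun i j => by simp only [h.1 i j]) (ps_nonneg (psd_diag h 0))
    (fun hc j => by simp only [psd_zero h (ps_eq_zero hc), ps_zero]) ?_
  have hS := schur_psd_s17 h
  refine ⟨fun i j => ?_, fun y => ?_⟩
  · rw [ps_schur, ps_schur, h.1 i.succ, mul_comm (M 0 i.succ)]
  · have hdet := form_det (a := schur M 0 0) (b := schur M 0 1) (d := schur M 1 1) (by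
      intro u v
      have := hS.2 ![u, v]
      simp [Fin.sum_univ_two, hS.1 1 0] at this
      nlinarith)
    have h0 := psd_diag h 0
    have key := path_lemma hβ hdet.1 hdet.2.1 hdet.2.2 (e := M 0 1 * M 0 1 / M 0 0)
      (f := M 0 1 * M 0 2 / M 0 0) (g := M 0 2 * M 0 2 / M 0 0)
      (div_nonneg (mul_self_nonneg _) h0) (div_nonneg (mul_self_nonneg _) h0)
      (le_of_eq (by ring)) (y 0) (y 1)
    simp only [Fin.sum_univ_two, ps_schur]
    simp only [schur, Fin.succ_zero_eq_one, Fin.succ_one_eq_two, add_sub_cancel] at key ⊢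
    rw [h.1 2 1, mul_comm (M 0 2) (M 0 1)]
    linarith

lemma ps_cycle {β : ℝ} (hβ : 1 ≤ β) (n : ℕ) : ∀ M : Fin (n + 3) → Fin (n + 3) → ℝ, Psd M →
    (∀ i j : Fin (n + 3), i.val + 1 < j.val → ¬ (i.val = 0 ∧ j.val = n + 2) → M i j = 0) →
    Psd (fun i j => ps β (M i j)) := by
  induction n with
  | zero => intro M h _; exact ps_three hβ M h
  | succ n ih =>
    intro M h hz
    have hS := schur_psd_s17 h
    have hz0 : ∀ j : Fin (n + 3), j.val ≠ 0 → j.val ≠ n + 2 → M 0 j.succ = 0 := by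
      intro j h1 h2
      apply hz
      · simp only [Fin.val_zero, Fin.val_succ]; omega
      · simp only [Fin.val_zero, Fin.val_succ]; omega
    refine psd_of_schur (fun i j => by simp only [h.1 i j]) (ps_nonneg (psd_diag h 0))
      (fun hc j => by simp only [psd_zero h (ps_eq_zero hc), ps_zero]) ?_
    have hI := ih (schur M) hS (by
      intro i j hij hne
      have e1 : M i.succ j.succ = 0 := hz _ _ (by simpa using hij) (by simp)
      have e2 : M 0 i.succ * M 0 j.succ = 0 := by
        by_cases hi : i.val = 0
        · rw [hz0 j (by omega) (fun h => hne ⟨hi, h⟩), mul_zero]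
        · rw [hz0 i hi (by have := j.isLt; omega), zero_mul]
      simp [schur, e1, e2])
    refine ⟨fun i j => ?_, fun y => ?_⟩
    · rw [ps_schur, ps_schur, h.1 i.succ, mul_comm (M 0 i.succ)]
    refine (hI.2 y).trans ?_
    refine Finset.sum_le_sum fun i _ => Finset.sum_le_sum fun j _ => ?_
    by_cases hij : i = j
    · subst hij
      have h1 : ps β (schur M i i) ≤ schur (fun i j => ps β (M i j)) i i := by
        rw [ps_schur]
        exact ps_super hβ (div_nonneg (mul_self_nonneg _) (psd_diag h 0))
          (sub_nonneg.1 (psd_diag hS i))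
      nlinarith [mul_self_nonneg (y i)]
    · refine le_of_eq ?_
      suffices hh : ps β (schur M i j) = schur (fun i j => ps β (M i j)) i j by
        simp only [hh]
      rw [ps_schur]
      unfold schur
      have hij' : i.val ≠ j.val := fun h => hij (Fin.ext h)
      have hcase : M 0 i.succ = 0 ∨ M 0 j.succ = 0 ∨ M i.succ j.succ = 0 := by
        by_cases hi : i.val = 0
        · by_cases hj : j.val = n + 2
          · right; right; exact hz _ _ (by simp; omega) (by simp)
          · right; left; exact hz0 j (by omega) hj
        · by_cases hi' : i.val = n + 2
          · by_cases hj : j.val = 0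
            · right; right; rw [h.1]; exact hz _ _ (by simp; omega) (by simp)
            · right; left; exact hz0 j hj (by omega)
          · left; exact hz0 i hi hi'
      rcases hcase with h' | h' | h' <;> simp [h', ps_zero, ps_neg]

lemma phi_eq {α : ℝ} (hα : 2 ≤ α) (x : ℝ) : phiF α x = ps (α / 2) (x * x) := by
  rw [ps_of_nonneg (by linarith) (mul_self_nonneg x)]
  unfold phiF
  split_ifs with h
  · rw [h, mul_zero, Real.zero_rpow (by linarith)]
  · rw [← abs_mul_abs_self, ← sq, ← Real.rpow_natCast, ← Real.rpow_mul (abs_nonneg _)]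
    congr 1; push_cast; ring

lemma phiF_zero (α : ℝ) : phiF α 0 = 0 := by simp [phiF]

lemma mem_of_two_le (n : ℕ) {α : ℝ} (hα : 2 ≤ α) :
    α ∈ HSetPhi (SimpleGraph.cycleGraph (n + 3)) := by
  intro A hA
  obtain ⟨h1, -, h3⟩ := hA
  refine ⟨?_, fun _ _ => Set.mem_univ _, fun i j hij hadj => ?_⟩
  · have h2 := h1.hadamard h1
    rw [psd_iff_s17] at h2 ⊢
    have := ps_cycle (β := α / 2) (by linarith) n _ h2 (by
      intro i j hij hne
      have : A i j = 0 := by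
        apply h3
        · rintro rfl; omega
        · rw [SimpleGraph.cycleGraph_adj']
          have := j.isLt
          rw [Fin.val_sub, Fin.val_sub]
          rintro (h | h)
          · rw [Nat.mod_eq_of_lt (by omega)] at h
            omega
          · rw [show n + 3 - i.val + j.val = (j.val - i.val) + (n + 3) by omega, Nat.add_mod_right,
              Nat.mod_eq_of_lt (by omega)] at h
            omega
      simp [this])
    have e : A.map (phiF α) = fun i j => ps (α / 2) ((A ⊙ A) i j) := by
      ext i j
      simp [phi_eq hα]
    rw [e]; exact this
  · simp [h3 i j hij hadj, phiF_zero]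

/-- cyclic tridiagonal kernel -/
noncomputable def cyc {m : ℕ} (d w : Fin (m + 3) → ℝ) (i j : Fin (m + 3)) : ℝ :=
  (if i = j then d i else 0) + (if i + 1 = j then w i else 0) + (if j + 1 = i then w j else 0)

/-- its quadratic form -/
noncomputable def qf {m : ℕ} (d w x : Fin (m + 3) → ℝ) : ℝ :=
  ∑ i, (d i * x i ^ 2 + 2 * (w i * (x i * x (i + 1))))

lemma cyc_quad {m : ℕ} (d w x : Fin (m + 3) → ℝ) :
    ∑ i, ∑ j, x i * cyc d w i j * x j = qf d w x := by
  simp only [cyc, mul_add, add_mul, Finset.sum_add_distrib, qf]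
  have h1 : ∑ i, ∑ j, x i * (if i = j then d i else 0) * x j = ∑ i, d i * x i ^ 2 := by
    refine Finset.sum_congr rfl fun i _ => ?_
    simp; ring
  have h2 : ∑ i, ∑ j, x i * (if i + 1 = j then w i else 0) * x j
      = ∑ i, w i * (x i * x (i + 1)) := by
    refine Finset.sum_congr rfl fun i _ => ?_
    simp; ring
  have h3 : ∑ i, ∑ j, x i * (if j + 1 = i then w j else 0) * x j
      = ∑ i, w i * (x i * x (i + 1)) := by
    rw [Finset.sum_comm]
    refine Finset.sum_congr rfl fun i _ => ?_
    simp; ring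
  rw [h1, h2, h3, ← Finset.mul_sum]; ring

lemma fin_ne1 {m : ℕ} (i : Fin (m + 3)) : i + 1 ≠ i := by
  intro h
  have := congrArg Fin.val h
  rw [Fin.val_add_one] at this
  split_ifs at this with h'
  · subst h'; simp at this
  · omega

lemma fin_ne2 {m : ℕ} (i : Fin (m + 3)) : i + 1 + 1 ≠ i := by
  intro h
  rw [add_assoc] at h
  have := congrArg Fin.val (left_eq_add.1 h.symm)
  rw [Fin.val_add] at this
  simp only [Fin.val_one, Fin.val_zero] at this
  rw [Nat.mod_eq_of_lt (by omega)] at this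
  omega

lemma cyc_map {m : ℕ} (d w : Fin (m + 3) → ℝ) (f : ℝ → ℝ) (hf : f 0 = 0) (i j) :
    f (cyc d w i j) = cyc (fun i => f (d i)) (fun i => f (w i)) i j := by
  unfold cyc
  by_cases h1 : i = j
  · subst h1; simp
  · by_cases h2 : i + 1 = j
    · subst h2; simp [fin_ne2, h1]
    · by_cases h3 : j + 1 = i
      · simp [h1, h2, h3]
      · simp [h1, h2, h3, hf]

lemma cyc_mem {m : ℕ} {α : ℝ} (hα : α ∈ HSetPhi (SimpleGraph.cycleGraph (m + 3)))
    (d w : Fin (m + 3) → ℝ) (h : ∀ x, 0 ≤ qf d w x) (x : Fin (m + 3) → ℝ) :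
    0 ≤ qf (fun i => phiF α (d i)) (fun i => phiF α (w i)) x := by
  have := hα (Matrix.of (cyc d w)) ⟨?_, fun _ _ => Set.mem_univ _, fun i j hij hadj => ?_⟩
  · have := ((psd_iff_s17 _).1 this.1).2 x
    rw [← cyc_quad]
    refine this.trans_eq ?_
    refine Finset.sum_congr rfl fun i _ => Finset.sum_congr rfl fun j _ => ?_
    simp only [Matrix.map_apply, Matrix.of_apply, cyc_map d w _ (phiF_zero α)]
  · rw [psd_iff_s17]
    refine ⟨fun i j => ?_, fun x => ?_⟩
    · simp only [Matrix.of_apply, cyc]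
      by_cases hij : i = j
      · subst hij; rfl
      · simp [hij, Ne.symm hij, add_comm]
    · simpa only [Matrix.of_apply, cyc_quad] using h x
  · have hadj : ¬ (i - j = 1 ∨ j - i = 1) := by
      rw [← SimpleGraph.cycleGraph_adj]; exact hadj
    have h1 : ¬ (i + 1 = j) := fun h => hadj (Or.inr (by rw [← h]; simp))
    have h2 : ¬ (j + 1 = i) := fun h => hadj (Or.inl (by rw [← h]; simp))
    simp [cyc, hij, h1, h2]

lemma phiF_one (α : ℝ) : phiF α 1 = 1 := by simp [phiF]
lemma phiF_neg_one (α : ℝ) : phiF α (-1) = 1 := by simp [phiF]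

lemma four_le {α : ℝ} (hα : α ∈ HSetPhi (SimpleGraph.cycleGraph 4)) : 2 ≤ α := by
  have h2 : √2 ^ 2 = 2 := Real.sq_sqrt (by norm_num)
  have h0 : 0 < √2 := by positivity
  have := cyc_mem (m := 1) hα (fun _ => √2) (![1, 1, 1, -1]) (by
    intro x
    have e : qf (m := 1) (fun _ => √2) (![1, 1, 1, -1]) x =
      √2 * ((x 1 + (x 0 + x 2) / √2) ^ 2 + (x 3 + (x 2 - x 0) / √2) ^ 2) := by
      unfold qf
      refine (Fin.sum_univ_four _).trans ?_
      have e1 : (0 : Fin 4) + 1 = 1 := rfl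
      have e2 : (1 : Fin 4) + 1 = 2 := rfl
      have e3 : (2 : Fin 4) + 1 = 3 := rfl
      have e4 : (3 : Fin 4) + 1 = 0 := rfl
      rw [e1, e2, e3, e4]
      simp
      field_simp
      linear_combination (x 0 ^ 2 + x 2 ^ 2) * h2
    rw [e]; positivity) (![1, -1, 1, -1])
  have e : qf (m := 1) (fun _ => phiF α √2) (fun i => phiF α ((![1, 1, 1, -1] : Fin 4 → ℝ) i)) (![1, -1, 1, -1])
      = 4 * phiF α √2 - 8 := by
    unfold qf
    refine (Fin.sum_univ_four _).trans ?_
    have e1 : (0 : Fin 4) + 1 = 1 := rfl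
    have e2 : (1 : Fin 4) + 1 = 2 := rfl
    have e3 : (2 : Fin 4) + 1 = 3 := rfl
    have e4 : (3 : Fin 4) + 1 = 0 := rfl
    rw [e1, e2, e3, e4]
    simp [phiF_one, phiF_neg_one]
    ring
  have h3 : 2 ≤ phiF α √2 := by
    have := this.trans_eq e
    linarith
  rw [phiF, if_neg h0.ne', abs_of_pos h0] at h3
  by_contra hlt
  push Not at hlt
  have : √2 ^ α < √2 ^ (2 : ℝ) := Real.rpow_lt_rpow_of_exponent_lt (Real.one_lt_sqrt_two) hlt
  rw [Real.rpow_two, h2] at this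
  linarith

lemma fin_two (m : ℕ) : (1 : Fin (m + 4)) + 1 = 2 := by
  apply Fin.ext
  rw [Fin.val_add]
  rfl

lemma one_le_exp {m : ℕ} {α : ℝ} (hα : α ∈ HSetPhi (SimpleGraph.cycleGraph (m + 4))) : 1 ≤ α := by
  have := cyc_mem (m := m + 1) hα (Fin.cons 1 (Fin.cons 2 (Fin.cons 1 (fun _ => 0))))
    (Fin.cons 1 (Fin.cons 1 (fun _ => 0))) (by
    intro x
    have e : qf (m := m + 1) (Fin.cons 1 (Fin.cons 2 (Fin.cons 1 (fun _ => 0))))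
        (Fin.cons 1 (Fin.cons 1 (fun _ => 0))) x = (x 0 + x 1) ^ 2 + (x 1 + x 2) ^ 2 := by
      unfold qf
      simp [Fin.sum_univ_succ, Fin.succ_one_eq_two, fin_two]
      ring
    rw [e]; positivity) (Fin.cons 1 (Fin.cons (-1) (Fin.cons 1 (fun _ => 0))))
  have e : qf (m := m + 1) (fun i => phiF α ((Fin.cons 1 (Fin.cons 2 (Fin.cons 1 (fun _ => 0))) : Fin (m + 4) → ℝ) i))
    (fun i => phiF α ((Fin.cons 1 (Fin.cons 1 (fun _ => 0)) : Fin (m + 4) → ℝ) i))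
    (Fin.cons 1 (Fin.cons (-1) (Fin.cons 1 (fun _ => 0)))) = phiF α 2 - 2 := by
    unfold qf
    have e0 : (2 : Fin (m + 4)) = Fin.succ (Fin.succ 0) := by simp [Fin.succ_one_eq_two]
    have e1 : (1 : Fin (m + 4)) = Fin.succ 0 := by simp
    simp [Fin.sum_univ_succ, phiF_one, phiF_zero]
    rw [fin_two, e0]
    simp only [Fin.cons_succ, Fin.cons_zero]
    ring
  have h3 : 2 ≤ phiF α 2 := by
    have := this.trans_eq e
    linarith
  rw [phiF, if_neg two_ne_zero, abs_of_pos two_pos] at h3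
  by_contra hlt
  push Not at hlt
  have : (2:ℝ) ^ α < 2 ^ (1 : ℝ) := Real.rpow_lt_rpow_of_exponent_lt (by norm_num) hlt
  rw [Real.rpow_one] at this
  linarith

lemma sum_shift {m : ℕ} (g : Fin (m + 3) → ℝ) : ∑ i, g (i + 1) = ∑ i, g i :=
  Equiv.sum_comp (Equiv.addRight (1 : Fin (m + 3))) g

lemma one_not {m : ℕ} (hm : Even (m + 3)) :
    (1 : ℝ) ∉ HSetPhi (SimpleGraph.cycleGraph (m + 3)) := by
  intro hα
  set N : ℝ := ((m + 3 : ℕ) : ℝ) with hN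
  have hN3 : 3 ≤ N := by rw [hN]; push_cast; linarith [(Nat.cast_nonneg m : (0:ℝ) ≤ m)]
  let d : Fin (m + 3) → ℝ := fun i => 2 - if i = 0 then 4 / N else 0
  let w : Fin (m + 3) → ℝ := fun i => if i = Fin.last (m + 2) then -1 else 1
  have hodd : (-1 : ℝ) ^ (m + 2) = -1 := by
    apply Odd.neg_one_pow
    rcases hm with ⟨k, hk⟩
    exact ⟨k - 1, by omega⟩
  have hw2 : ∀ i, w i ^ 2 = 1 := by intro i; simp only [w]; split_ifs <;> norm_num
  have key := cyc_mem hα d w (by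
    intro x
    have e1 : qf d w x = ∑ i, (x i + w i * x (i + 1)) ^ 2 - 4 / N * x 0 ^ 2 := by
      have e2 : ∑ i, (x i + w i * x (i + 1)) ^ 2
          = ∑ i, (2 * x i ^ 2 + 2 * (w i * (x i * x (i + 1)))) := by
        have : ∀ i, (x i + w i * x (i + 1)) ^ 2
            = (x i ^ 2 + 2 * (w i * (x i * x (i + 1)))) + x (i + 1) ^ 2 := by
          intro i; linear_combination (x (i + 1)) ^ 2 * hw2 i
        simp only [this]
        rw [Finset.sum_add_distrib, sum_shift (fun i => x i ^ 2), ← Finset.sum_add_distrib]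
        refine Finset.sum_congr rfl fun i _ => ?_
        ring
      have e3 : 4 / N * x 0 ^ 2 = ∑ i, (if i = 0 then 4 / N else 0) * x i ^ 2 := by
        simp
      rw [e2, e3, ← Finset.sum_sub_distrib]
      unfold qf
      refine Finset.sum_congr rfl fun i _ => ?_
      simp only [d]; ring
    have tele : ∑ i : Fin (m + 3), (-1 : ℝ) ^ i.val * (x i + w i * x (i + 1)) = 2 * x 0 := by
      have : ∀ i : Fin (m + 3), (-1 : ℝ) ^ i.val * (x i + w i * x (i + 1))
          = (-1 : ℝ) ^ i.val * x i - (-1 : ℝ) ^ (i + 1).val * x (i + 1)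
            + if i = Fin.last (m + 2) then 2 * x 0 else 0 := by
        intro i
        by_cases hi : i = Fin.last (m + 2)
        · subst hi
          simp [w, hodd]; ring
        · simp [w, hi, Fin.val_add_one, pow_succ]; ring
      simp only [this]
      rw [Finset.sum_add_distrib, Finset.sum_sub_distrib,
        sum_shift (fun i => (-1 : ℝ) ^ i.val * x i)]
      simp
    have cs := sq_sum_le_card_mul_sum_sq (s := Finset.univ)
      (f := fun i : Fin (m + 3) => (-1 : ℝ) ^ i.val * (x i + w i * x (i + 1)))
    rw [tele] at cs
    simp only [mul_pow, ← pow_mul, Finset.card_univ, Fintype.card_fin, mul_comm _ 2, pow_mul (-1:ℝ) 2,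
      neg_one_sq, one_pow, one_mul, ← hN] at cs
    rw [e1, sub_nonneg, div_mul_eq_mul_div, div_le_iff₀ (by linarith)]
    linarith) (fun i => (-1 : ℝ) ^ i.val)
  have hf : ∀ x, phiF 1 x = |x| := by
    intro x; unfold phiF; split_ifs with h <;> simp [h]
  have hwa : ∀ i, |w i| = 1 := by intro i; simp only [w]; split_ifs <;> norm_num
  have hda : ∀ i, |d i| = d i := by
    intro i
    apply abs_of_nonneg
    simp only [d]
    have : 4 / N ≤ 2 := by rw [div_le_iff₀ (by linarith)]; linarith
    split_ifs <;> linarith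
  have hy : ∀ i : Fin (m + 3), (-1 : ℝ) ^ i.val * (-1 : ℝ) ^ (i + 1).val = -1 := by
    intro i
    by_cases hi : i = Fin.last (m + 2)
    · subst hi; simp [hodd]
    · simp [hi, Fin.val_add_one, pow_succ, ← mul_pow]
  unfold qf at key
  simp only [hf, hwa, hda, hy, ← pow_mul, mul_comm _ 2, pow_mul (-1:ℝ) 2, neg_one_sq, one_pow] at key
  simp [d, Finset.sum_add_distrib] at key
  have : 0 < 4 / N := by positivity
  linarith

/-- `H_{C_4}^φ = [2, ∞)`; for `n > 4`, `[2, ∞) ⊆ H_{C_n}^φ ⊆ [1, ∞)`, and `1 ∉ H_{C_n}^φ`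
when `n` is even. -/
theorem stmt17 :
    HSetPhi (SimpleGraph.cycleGraph 4) = Set.Ici 2 ∧
    ∀ n : ℕ, 4 < n →
      Set.Ici 2 ⊆ HSetPhi (SimpleGraph.cycleGraph n) ∧
      HSetPhi (SimpleGraph.cycleGraph n) ⊆ Set.Ici 1 ∧
      (Even n → (1 : ℝ) ∉ HSetPhi (SimpleGraph.cycleGraph n)) := by
  refine ⟨Set.Subset.antisymm (fun α h => four_le h) (fun α h => mem_of_two_le 1 h), ?_⟩
  intro n hn
  obtain ⟨k, rfl⟩ : ∃ k, n = k + 4 := ⟨n - 4, by omega⟩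
  exact ⟨fun α h => mem_of_two_le (k + 1) h, fun α h => one_le_exp h, fun h => one_not (m := k + 1) h⟩
end
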